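/- arXiv:2105.03871 — 11 statements merged into one kernel-verified Lean document; each statement's English description precedes it below -/
import Mathlib

section
/- For every k ∈ (0,1), the upward Landen transformation holds: K(k) = (1/(1+k)) · K(2√k/(1+k)), i.e. ∫₀¹ dt/√((1−t²)(1−k²t²)) = (1/(1+k)) · ∫₀¹ dt/√((1−t²)(1−(2√k/(1+k))²·t²)). -/
open MeasureTheory

/-- The complete elliptic integral of the first kind `K(k)`. -/
noncomputable def ellK (k : ℝ) : ℝ :=
  ∫ t in (0:ℝ)..1, 1 / Real.sqrt ((1 - t ^ 2) * (1 - k ^ 2 * t ^ 2))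

/-- The Gauss substitution `s ↦ (1 + k) s / (1 + k s²)`, an increasing bijection of `(0, 1)`. -/
noncomputable def gaussSubst (k s : ℝ) : ℝ :=
  (1 + k) * s / (1 + k * s ^ 2)

lemma hasDerivAt_gaussSubst {k : ℝ} (hk : 0 ≤ k) (s : ℝ) :
    HasDerivAt (gaussSubst k) ((1 + k) * (1 - k * s ^ 2) / (1 + k * s ^ 2) ^ 2) s := by
  have hD : 1 + k * s ^ 2 ≠ 0 := by positivity
  have hnum : HasDerivAt (fun s : ℝ => (1 + k) * s) (1 + k) s := by
    simpa using (hasDerivAt_id s).const_mul (1 + k)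
  have hden : HasDerivAt (fun s : ℝ => 1 + k * s ^ 2) (k * (2 * s)) s := by
    simpa using ((hasDerivAt_pow 2 s).const_mul k).const_add 1
  refine (hnum.div hden hD).congr_deriv ?_
  congr 1
  ring

lemma strictMonoOn_gaussSubst {k : ℝ} (hk : k ∈ Set.Ioo (0 : ℝ) 1) :
    StrictMonoOn (gaussSubst k) (Set.Icc 0 1) := by
  obtain ⟨hk0, hk1⟩ := hk
  rintro a ⟨ha0, ha1⟩ b ⟨hb0, hb1⟩ hab
  have hkab : k * (a * b) < 1 := by
    have : a * b ≤ 1 := mul_le_one₀ ha1 hb0 hb1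
    nlinarith
  unfold gaussSubst
  rw [div_lt_div_iff₀ (by positivity) (by positivity)]
  have : 0 < (1 + k) * ((b - a) * (1 - k * (a * b))) :=
    mul_pos (by linarith) (mul_pos (by linarith) (by linarith))
  linarith

lemma image_gaussSubst_Ioo {k : ℝ} (hk : k ∈ Set.Ioo (0 : ℝ) 1) :
    gaussSubst k '' Set.Ioo 0 1 = Set.Ioo 0 1 := by
  have h0 : gaussSubst k 0 = 0 := by simp [gaussSubst]
  have h1 : gaussSubst k 1 = 1 := by
    have : 1 + k ≠ 0 := by linarith [hk.1]
    simp [gaussSubst, this]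
  have hmono := strictMonoOn_gaussSubst hk
  apply Set.Subset.antisymm
  · rintro _ ⟨s, hs, rfl⟩
    have hs' := Set.Ioo_subset_Icc_self hs
    constructor
    · simpa only [h0] using hmono (Set.left_mem_Icc.2 zero_le_one) hs' hs.1
    · simpa only [h1] using hmono hs' (Set.right_mem_Icc.2 zero_le_one) hs.2
  · have hcont : ContinuousOn (gaussSubst k) (Set.Icc 0 1) := fun s _ =>
      (hasDerivAt_gaussSubst hk.1.le s).continuousAt.continuousWithinAt
    simpa only [h0, h1] using intermediate_value_Ioo zero_le_one hcont

lemma ellK_eq_integral_Ioo (k : ℝ) :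
    ellK k = ∫ t in Set.Ioo (0 : ℝ) 1, 1 / Real.sqrt ((1 - t ^ 2) * (1 - k ^ 2 * t ^ 2)) := by
  rw [ellK, intervalIntegral.integral_of_le zero_le_one, integral_Ioc_eq_integral_Ioo]

lemma sqrt_gaussSubst {k s : ℝ} (hk : k ∈ Set.Ioo (0 : ℝ) 1) (hs : s ∈ Set.Ioo (0 : ℝ) 1) :
    Real.sqrt ((1 - gaussSubst k s ^ 2) *
        (1 - (2 * Real.sqrt k / (1 + k)) ^ 2 * gaussSubst k s ^ 2)) =
      (1 - k * s ^ 2) / (1 + k * s ^ 2) ^ 2 *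
        Real.sqrt ((1 - s ^ 2) * (1 - k ^ 2 * s ^ 2)) := by
  obtain ⟨hk0, hk1⟩ := hk
  obtain ⟨hs0, hs1⟩ := hs
  have hD : 1 + k * s ^ 2 ≠ 0 := by positivity
  have hk' : 1 + k ≠ 0 := by positivity
  have hN : 0 ≤ (1 - k * s ^ 2) / (1 + k * s ^ 2) ^ 2 := by
    apply div_nonneg _ (by positivity)
    nlinarith
  rw [← Real.sqrt_sq hN, ← Real.sqrt_mul (sq_nonneg _)]
  congr 1
  rw [div_pow (2 * √k), mul_pow, Real.sq_sqrt hk0.le, gaussSubst]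
  field_simp
  ring

/-- The upward Landen transformation:
`K(k) = (1/(1+k)) · K(2√k/(1+k))` for every `k ∈ (0,1)`. -/
theorem upward_landen (k : ℝ) (hk : k ∈ Set.Ioo (0:ℝ) 1) :
    ellK k = (1 / (1 + k)) * ellK (2 * Real.sqrt k / (1 + k)) := by
  have hk' : 0 < 1 + k := by linarith [hk.1]
  rw [ellK_eq_integral_Ioo (2 * Real.sqrt k / (1 + k))]
  nth_rewrite 1 [← image_gaussSubst_Ioo hk]
  rw [integral_image_eq_integral_abs_deriv_smul measurableSet_Ioo
      (fun s _ => (hasDerivAt_gaussSubst hk.1.le s).hasDerivWithinAt)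
      ((strictMonoOn_gaussSubst hk).injOn.mono Set.Ioo_subset_Icc_self),
    ← integral_const_mul, ellK_eq_integral_Ioo]
  refine setIntegral_congr_fun measurableSet_Ioo fun s hs => ?_
  have hD : 0 < 1 + k * s ^ 2 := by have := hk.1; positivity
  have hN : 0 < 1 - k * s ^ 2 := by nlinarith [hk.1, hk.2, hs.1, hs.2]
  have hR : 0 < Real.sqrt ((1 - s ^ 2) * (1 - k ^ 2 * s ^ 2)) := by
    refine Real.sqrt_pos.2 (mul_pos ?_ ?_)
    · nlinarith [hs.1, hs.2]
    · have : k * s < 1 := by nlinarith [hk.1, hk.2, hs.1, hs.2]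
      have : 0 < k * s := mul_pos hk.1 hs.1
      nlinarith
  simp only [smul_eq_mul]
  rw [sqrt_gaussSubst hk hs, abs_of_pos (by positivity)]
  generalize Real.sqrt ((1 - s ^ 2) * (1 - k ^ 2 * s ^ 2)) = R at hR ⊢
  generalize 1 + k * s ^ 2 = D at hD ⊢
  generalize 1 - k * s ^ 2 = N at hN ⊢
  field_simp
end

section
/- For every k ∈ (0,1), the downward Landen transformation holds: K'(k) = (2/(1+k)) · K((1−k)/(1+k)), i.e. ∫₀¹ dt/√((1−t²)(1−(1−k²)t²)) = (2/(1+k)) · ∫₀¹ dt/√((1−t²)(1−((1−k)/(1+k))²·t²)). -/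
open MeasureTheory

/-- The complementary complete elliptic integral `K'(k) = K(√(1-k²))`,
written with modulus squared `1 - k²`. -/
noncomputable def ellK' (k : ℝ) : ℝ :=
  ∫ t in (0:ℝ)..1, 1 / Real.sqrt ((1 - t ^ 2) * (1 - (1 - k ^ 2) * t ^ 2))

/-- The Gauss change of variables on the unit interval. -/
noncomputable def gaussMap (m s : ℝ) : ℝ := (1 + m) * s / (1 + m * s ^ 2)

theorem one_add_mul_sq_pos {m : ℝ} (hm : 0 ≤ m) (s : ℝ) : 0 < 1 + m * s ^ 2 := by
  positivity

theorem hasDerivAt_gaussMap {m : ℝ} (hm : 0 ≤ m) (s : ℝ) :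
    HasDerivAt (gaussMap m) ((1 + m) * (1 - m * s ^ 2) / (1 + m * s ^ 2) ^ 2) s := by
  have h1 : HasDerivAt (fun s : ℝ => (1 + m) * s) ((1 + m) * 1) s :=
    (hasDerivAt_id s).const_mul _
  have h2 : HasDerivAt (fun s : ℝ => 1 + m * s ^ 2) (m * (2 * s)) s := by
    simpa using ((hasDerivAt_pow 2 s).const_mul m).const_add 1
  refine (h1.div h2 (one_add_mul_sq_pos hm s).ne').congr_deriv ?_
  ring

theorem injOn_gaussMap {m : ℝ} (hm : m ∈ Set.Ioo (0 : ℝ) 1) :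
    Set.InjOn (gaussMap m) (Set.Ioo 0 1) := by
  obtain ⟨hm0, hm1⟩ := hm
  rintro a ⟨ha0, ha1⟩ b ⟨hb0, hb1⟩ hab
  simp only [gaussMap] at hab
  rw [div_eq_div_iff (one_add_mul_sq_pos hm0.le a).ne' (one_add_mul_sq_pos hm0.le b).ne'] at hab
  have hlt : m * (a * b) < 1 :=
    mul_lt_one_of_nonneg_of_lt_one_left hm0.le hm1
      (mul_lt_one_of_nonneg_of_lt_one_left ha0.le ha1 hb1.le).le
  have h : ((1 + m) * (1 - m * (a * b))) * (a - b) = 0 := by linear_combination hab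
  have hne : (1 + m) * (1 - m * (a * b)) ≠ 0 :=
    (mul_pos (by linarith) (by linarith)).ne'
  linarith [(mul_eq_zero.mp h).resolve_left hne]

theorem one_sub_gaussMap_sq {m : ℝ} (hm : 0 ≤ m) (s : ℝ) :
    1 - gaussMap m s ^ 2 = (1 - s ^ 2) * (1 - m ^ 2 * s ^ 2) / (1 + m * s ^ 2) ^ 2 := by
  have h := (one_add_mul_sq_pos hm s).ne'
  unfold gaussMap
  field_simp
  ring

theorem image_gaussMap {m : ℝ} (hm : m ∈ Set.Ioo (0 : ℝ) 1) :
    gaussMap m '' Set.Ioo 0 1 = Set.Ioo 0 1 := by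
  obtain ⟨hm0, hm1⟩ := hm
  apply Set.Subset.antisymm
  · rintro _ ⟨s, ⟨hs0, hs1⟩, rfl⟩
    have hpos : 0 < gaussMap m s := by unfold gaussMap; positivity
    have h1 : 0 < 1 - gaussMap m s ^ 2 := by
      rw [one_sub_gaussMap_sq hm0.le]
      have : s ^ 2 < 1 := by nlinarith
      have : m ^ 2 * s ^ 2 < 1 := by
        rw [← mul_pow]
        exact pow_lt_one₀ (by positivity) (by nlinarith) two_ne_zero
      have := one_add_mul_sq_pos hm0.le s
      exact div_pos (mul_pos (by linarith) (by linarith)) (by positivity)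
    exact ⟨hpos, by nlinarith⟩
  · have hc : ContinuousOn (gaussMap m) (Set.Icc 0 1) := fun s _ =>
      (hasDerivAt_gaussMap hm0.le s).continuousAt.continuousWithinAt
    have h := intermediate_value_Ioo zero_le_one hc
    have h0 : gaussMap m 0 = 0 := by simp [gaussMap]
    have h1 : gaussMap m 1 = 1 := by
      simp only [gaussMap, one_pow, mul_one]
      exact div_self (by linarith)
    rwa [h0, h1] at h

/-- The Gauss transformation of the complete elliptic integral. -/
theorem integral_gauss_transformation {m : ℝ} (hm : m ∈ Set.Ioo (0 : ℝ) 1) :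
    ∫ t in (0 : ℝ)..1, 1 / Real.sqrt ((1 - t ^ 2) * (1 - 4 * m / (1 + m) ^ 2 * t ^ 2)) =
      (1 + m) * ellK m := by
  have hm0 : 0 < m := hm.1
  rw [ellK, intervalIntegral.integral_of_le zero_le_one,
    intervalIntegral.integral_of_le zero_le_one, integral_Ioc_eq_integral_Ioo,
    integral_Ioc_eq_integral_Ioo, ← integral_const_mul]
  conv_lhs => rw [← image_gaussMap hm]
  rw [integral_image_eq_integral_abs_deriv_smul measurableSet_Ioo
    (fun s _ => (hasDerivAt_gaussMap hm0.le s).hasDerivWithinAt) (injOn_gaussMap hm)]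
  refine setIntegral_congr_fun measurableSet_Ioo ?_
  rintro s ⟨hs0, hs1⟩
  have hD := one_add_mul_sq_pos hm0.le s
  have hN : 0 < 1 - m * s ^ 2 := by
    have : m * s ^ 2 < 1 :=
      mul_lt_one_of_nonneg_of_lt_one_left hm0.le hm.2 (pow_le_one₀ hs0.le hs1.le)
    linarith
  have hrad : (1 - gaussMap m s ^ 2) * (1 - 4 * m / (1 + m) ^ 2 * gaussMap m s ^ 2) =
      ((1 - s ^ 2) * (1 - m ^ 2 * s ^ 2)) * ((1 - m * s ^ 2) / (1 + m * s ^ 2) ^ 2) ^ 2 := by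
    rw [one_sub_gaussMap_sq hm0.le]
    unfold gaussMap
    have : 1 + m ≠ 0 := by positivity
    field_simp
    ring
  have hq : 0 < (1 - m * s ^ 2) / (1 + m * s ^ 2) ^ 2 := by positivity
  simp only [smul_eq_mul]
  rw [hrad, Real.sqrt_mul' _ (sq_nonneg _), Real.sqrt_sq hq.le, mul_div_assoc,
    abs_of_pos (by positivity), one_div, one_div, mul_inv]
  field_simp

/-- The downward Landen transformation:
`K'(k) = (2/(1+k)) · K((1−k)/(1+k))` for every `k ∈ (0,1)`. -/
theorem downward_landen (k : ℝ) (hk : k ∈ Set.Ioo (0:ℝ) 1) :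
    ellK' k = (2 / (1 + k)) * ellK ((1 - k) / (1 + k)) := by
  obtain ⟨hk0, hk1⟩ := hk
  have hk : 0 < 1 + k := by linarith
  have hm : (1 - k) / (1 + k) ∈ Set.Ioo (0 : ℝ) 1 :=
    ⟨div_pos (by linarith) hk, (div_lt_one hk).mpr (by linarith)⟩
  have hsum : 1 + (1 - k) / (1 + k) = 2 / (1 + k) := by
    field_simp
    ring
  have hmod : 4 * ((1 - k) / (1 + k)) / (2 / (1 + k)) ^ 2 = 1 - k ^ 2 := by
    field_simp
    ring
  have h := integral_gauss_transformation hm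
  rwa [hsum, hmod] at h
end

section
/- For every k ∈ (0,1), the multiplication rule holds: K(k)/K'(k) = (1/2) · K(k*)/K'(k*), where k* = 2√k/(1+k). -/
open MeasureTheory

/-- The Landen (Gauss) map `s ↦ (1 + k) s / (1 + k s²)` sends `(0, 1)` onto itself. -/
theorem image_landen_Ioo {k : ℝ} (hk : k ∈ Set.Ioo (0:ℝ) 1) :
    (fun s : ℝ => (1 + k) * s / (1 + k * s ^ 2)) '' Set.Ioo 0 1 = Set.Ioo 0 1 := by
  obtain ⟨h0, h1⟩ := hk
  have hpos : ∀ s : ℝ, 0 < 1 + k * s ^ 2 := fun s => by positivity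
  apply Set.Subset.antisymm
  · rintro _ ⟨s, ⟨hs0, hs1⟩, rfl⟩
    refine ⟨div_pos (by positivity) (hpos s), (div_lt_one (hpos s)).2 ?_⟩
    have hks : k * s < 1 := by nlinarith
    nlinarith [mul_pos (sub_pos.2 hs1) (sub_pos.2 hks)]
  · have hcont : ContinuousOn (fun s : ℝ => (1 + k) * s / (1 + k * s ^ 2)) (Set.Icc 0 1) :=
      ContinuousOn.div (by fun_prop) (by fun_prop) fun s _ => (hpos s).ne'
    have h := intermediate_value_Ioo zero_le_one hcont
    have hk1 : (1 + k) / (1 + k) = 1 := div_self (by positivity)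
    simpa [hk1] using h

theorem injOn_landen {k : ℝ} (hk : k ∈ Set.Ioo (0:ℝ) 1) :
    Set.InjOn (fun s : ℝ => (1 + k) * s / (1 + k * s ^ 2)) (Set.Ioo 0 1) := by
  obtain ⟨h0, h1⟩ := hk
  rintro s ⟨hs0, hs1⟩ t ⟨ht0, ht1⟩ hst
  have hs : 1 + k * s ^ 2 ≠ 0 := by positivity
  have ht : 1 + k * t ^ 2 ≠ 0 := by positivity
  have hst' : (1 + k) * s * (1 + k * t ^ 2) = (1 + k) * t * (1 + k * s ^ 2) :=
    (div_eq_div_iff hs ht).1 hst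
  have hk1 : (1 + k) * (1 - k * (s * t)) ≠ 0 := by
    have h : s * t < 1 := by nlinarith
    have h' : k * (s * t) < 1 := by nlinarith [mul_pos hs0 ht0]
    exact mul_ne_zero (by positivity) (sub_pos.2 h').ne'
  have hz : (1 + k) * (1 - k * (s * t)) * (s - t) = 0 := by linear_combination hst'
  exact sub_eq_zero.1 ((mul_eq_zero.1 hz).resolve_left hk1)

theorem hasDerivAt_landen {k : ℝ} (hk : 0 < k) (s : ℝ) :
    HasDerivAt (fun s : ℝ => (1 + k) * s / (1 + k * s ^ 2))
      ((1 + k) * (1 - k * s ^ 2) / (1 + k * s ^ 2) ^ 2) s := by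
  have hs : 1 + k * s ^ 2 ≠ 0 := by positivity
  have hnum : HasDerivAt (fun s : ℝ => (1 + k) * s) (1 + k) s := by
    simpa using (hasDerivAt_id s).const_mul (1 + k)
  have hden : HasDerivAt (fun s : ℝ => 1 + k * s ^ 2) (k * (2 * s)) s := by
    simpa using ((hasDerivAt_pow 2 s).const_mul k).const_add 1
  exact (hnum.fun_div hden hs).congr_deriv (by ring)

/-- The ascending Landen transformation, with the new modulus given by its square
`4k / (1 + k)²`. -/
theorem integral_landen {k : ℝ} (hk : k ∈ Set.Ioo (0:ℝ) 1) :
    ∫ t in (0:ℝ)..1, 1 / Real.sqrt ((1 - t ^ 2) * (1 - 4 * k / (1 + k) ^ 2 * t ^ 2))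
      = (1 + k) * ellK k := by
  obtain ⟨h0, h1⟩ := hk
  rw [ellK, intervalIntegral.integral_of_le zero_le_one,
    intervalIntegral.integral_of_le zero_le_one, integral_Ioc_eq_integral_Ioo,
    integral_Ioc_eq_integral_Ioo]
  conv_lhs => rw [← image_landen_Ioo ⟨h0, h1⟩]
  rw [integral_image_eq_integral_abs_deriv_smul measurableSet_Ioo
    (fun s _ => (hasDerivAt_landen h0 s).hasDerivWithinAt) (injOn_landen ⟨h0, h1⟩),
    ← integral_const_mul]
  refine setIntegral_congr_fun measurableSet_Ioo ?_
  rintro s ⟨hs0, hs1⟩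
  have hk1 : 1 + k ≠ 0 := by positivity
  have hp : 0 < 1 + k * s ^ 2 := by positivity
  have hs2 : s ^ 2 < 1 := by nlinarith
  have hm : 0 < 1 - k * s ^ 2 := by nlinarith
  have hrad : (1 - ((1 + k) * s / (1 + k * s ^ 2)) ^ 2)
      * (1 - 4 * k / (1 + k) ^ 2 * ((1 + k) * s / (1 + k * s ^ 2)) ^ 2)
      = ((1 - k * s ^ 2) / (1 + k * s ^ 2) ^ 2) ^ 2 * ((1 - s ^ 2) * (1 - k ^ 2 * s ^ 2)) := by
    field_simp
    ring
  have hq : 0 < (1 - k * s ^ 2) / (1 + k * s ^ 2) ^ 2 := by positivity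
  simp only [smul_eq_mul]
  rw [hrad, Real.sqrt_mul (sq_nonneg _), Real.sqrt_sq hq.le, mul_div_assoc,
    abs_of_pos (by positivity), one_div, mul_inv, mul_assoc, mul_inv_cancel_left₀ hq.ne', one_div]

/-- The multiplication rule: `K(k)/K'(k) = (1/2) · K(k*)/K'(k*)` where
`k* = 2√k/(1+k)`, for every `k ∈ (0,1)`. -/
theorem multiplication_rule (k : ℝ) (hk : k ∈ Set.Ioo (0:ℝ) 1) :
    ellK k / ellK' k
      = (1 / 2) * (ellK (2 * Real.sqrt k / (1 + k)) / ellK' (2 * Real.sqrt k / (1 + k))) := by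
  have ⟨h0, h1⟩ := hk
  have hk1 : 1 + k ≠ 0 := by positivity
  have hsq : (2 * Real.sqrt k / (1 + k)) ^ 2 = 4 * k / (1 + k) ^ 2 := by
    rw [div_pow, mul_pow, Real.sq_sqrt h0.le]
    norm_num
  have hK : ellK (2 * Real.sqrt k / (1 + k)) = (1 + k) * ellK k := by
    rw [← integral_landen hk, ellK, hsq]
  have hl : (1 - k) / (1 + k) ∈ Set.Ioo (0:ℝ) 1 :=
    ⟨div_pos (by linarith) (by linarith), (div_lt_one (by linarith)).2 (by linarith)⟩
  have hl1 : 1 + (1 - k) / (1 + k) = 2 / (1 + k) := by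
    field_simp
    ring
  have hcompl : 1 - 4 * k / (1 + k) ^ 2 = ((1 - k) / (1 + k)) ^ 2 := by
    field_simp
    ring
  have hmod : 4 * ((1 - k) / (1 + k)) / (2 / (1 + k)) ^ 2 = 1 - k ^ 2 := by
    field_simp
    ring
  have hK' : ellK' k = 2 / (1 + k) * ellK' (2 * Real.sqrt k / (1 + k)) := by
    have h := integral_landen hl
    rw [hl1, hmod, ellK] at h
    rw [ellK', ellK', hsq, hcompl, h]
  rw [hK, hK', div_mul_eq_mul_div, div_div_eq_mul_div, mul_comm (ellK k), mul_comm (2:ℝ),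
    ← div_div]
  ring
end

section
/- The modulus k = √2 − 1 is the second singular modulus: K'(√2 − 1) = √2 · K(√2 − 1), i.e. ∫₀¹ dt/√((1−t²)(1−(2√2−2)t²)) = √2 · ∫₀¹ dt/√((1−t²)(1−(√2−1)²t²)). -/
open MeasureTheory

/-- **Landen's transformation** `K(2√k/(1+k)) = (1+k) K(k)` of the complete elliptic integral of
the first kind, via the substitution `t = (1+k)s/(1+ks²)`. -/
theorem integral_ellipticK_landen {k : ℝ} (hk₀ : 0 ≤ k) (hk₁ : k < 1) :
    (∫ t in (0:ℝ)..1, 1 / Real.sqrt ((1 - t ^ 2) * (1 - 4 * k / (1 + k) ^ 2 * t ^ 2)))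
      = (1 + k) * ∫ t in (0:ℝ)..1, 1 / Real.sqrt ((1 - t ^ 2) * (1 - k ^ 2 * t ^ 2)) := by
  set φ : ℝ → ℝ := fun s => (1 + k) * s / (1 + k * s ^ 2) with hφ
  have hden (s : ℝ) : 0 < 1 + k * s ^ 2 := by positivity
  have hderiv (s : ℝ) :
      HasDerivAt φ ((1 + k) * (1 - k * s ^ 2) / (1 + k * s ^ 2) ^ 2) s := by
    have h := ((hasDerivAt_id s).const_mul (1 + k)).div
      ((((hasDerivAt_id s).pow 2).const_mul k).const_add 1) (hden s).ne'
    refine h.congr_deriv ?_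
    simp only [id, Pi.pow_apply]
    congr 1
    push_cast
    ring
  have hlt {s r : ℝ} (hs : s ∈ Set.Ioo (0:ℝ) 1) (hr : r ∈ Set.Ioo (0:ℝ) 1) :
      k * (s * r) < 1 := by
    have : s * r < 1 := mul_lt_one_of_nonneg_of_lt_one_left hs.1.le hs.2 hr.2.le
    nlinarith [mul_pos hs.1 hr.1]
  have hinj : Set.InjOn φ (Set.Ioo 0 1) := by
    intro s hs r hr h
    rw [hφ] at h
    simp only at h
    rw [div_eq_div_iff (hden s).ne' (hden r).ne'] at h
    have h' : (1 + k) * (1 - k * (s * r)) * (s - r) = 0 := by linear_combination h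
    have hpos : 0 < (1 + k) * (1 - k * (s * r)) :=
      mul_pos (by linarith) (by linarith [hlt hs hr])
    exact sub_eq_zero.1 ((mul_eq_zero.1 h').resolve_left hpos.ne')
  have himage : φ '' Set.Ioo 0 1 = Set.Ioo 0 1 := by
    apply Set.Subset.antisymm
    · rintro _ ⟨s, hs, rfl⟩
      refine ⟨div_pos (mul_pos (by linarith) hs.1) (hden s), (div_lt_one (hden s)).2 ?_⟩
      have : 0 < (1 - s) * (1 - k * s) :=
        mul_pos (by linarith [hs.2]) (by nlinarith [hs.1, hs.2])
      linarith
    · have hcont : ContinuousOn φ (Set.Icc 0 1) :=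
        fun s _ => (hderiv s).continuousAt.continuousWithinAt
      have h := intermediate_value_Ioo zero_le_one hcont
      have h0 : φ 0 = 0 := by simp [hφ]
      have h1 : φ 1 = 1 := by
        have : 1 + k ≠ 0 := by linarith
        simp [hφ, this]
      rwa [h0, h1] at h
  rw [intervalIntegral.integral_of_le zero_le_one, intervalIntegral.integral_of_le zero_le_one,
    integral_Ioc_eq_integral_Ioo, integral_Ioc_eq_integral_Ioo, ← integral_const_mul]
  conv_lhs => rw [← himage]
  rw [integral_image_eq_integral_abs_deriv_smul measurableSet_Ioo
    (fun s _ => (hderiv s).hasDerivWithinAt) hinj]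
  refine setIntegral_congr_fun measurableSet_Ioo fun s hs => ?_
  have hnum : 0 < 1 - k * s ^ 2 := by nlinarith [hlt hs hs]
  have hk : 0 < 1 + k := by linarith
  have hd := hden s
  have hrad : (1 - φ s ^ 2) * (1 - 4 * k / (1 + k) ^ 2 * φ s ^ 2)
      = ((1 - s ^ 2) * (1 - k ^ 2 * s ^ 2)) * ((1 - k * s ^ 2) / (1 + k * s ^ 2) ^ 2) ^ 2 := by
    simp only [hφ]
    field_simp
    ring
  have hq : 0 < (1 - k * s ^ 2) / (1 + k * s ^ 2) ^ 2 := by positivity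
  simp only [smul_eq_mul]
  rw [hrad, Real.sqrt_mul' _ (sq_nonneg _), Real.sqrt_sq hq.le, mul_div_assoc,
    abs_of_pos (mul_pos hk hq), mul_assoc, ← div_div, mul_div_cancel₀ _ hq.ne']

/-- The second singular modulus: for `k = √2 − 1` one has `K'(k) = √2 · K(k)`, i.e.
`∫₀¹ dt/√((1−t²)(1−(2√2−2)t²)) = √2 · ∫₀¹ dt/√((1−t²)(1−(√2−1)²t²))`. -/
theorem second_singular_modulus :
    (∫ t in (0:ℝ)..1, 1 / Real.sqrt ((1 - t ^ 2) * (1 - (2 * Real.sqrt 2 - 2) * t ^ 2)))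
      = Real.sqrt 2 *
        ∫ t in (0:ℝ)..1, 1 / Real.sqrt ((1 - t ^ 2) * (1 - (Real.sqrt 2 - 1) ^ 2 * t ^ 2)) := by
  have hsq : Real.sqrt 2 ^ 2 = 2 := Real.sq_sqrt zero_le_two
  have hpos : 0 < Real.sqrt 2 := by positivity
  have h := integral_ellipticK_landen (k := Real.sqrt 2 - 1) (by nlinarith) (by nlinarith)
  rw [add_sub_cancel, hsq] at h
  rwa [show 4 * (Real.sqrt 2 - 1) / 2 = 2 * Real.sqrt 2 - 2 by ring] at h
end

section
/- The ratio of the two convergent improper integrals ∫₀¹ (x+1+√2)/√(x(1−x⁴)) dx and ∫₁^∞ (x+1+√2)/√(x(x⁴−1)) dx equals √2; that is, ∫₀¹ (x+1+√2)/√(x(1−x⁴)) dx = √2 · ∫₁^∞ (x+1+√2)/√(x(x⁴−1)) dx. -/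
open MeasureTheory

lemma integrableOn_one_div_sqrt_mul_one_sub_pow_four :
    IntegrableOn (fun x : ℝ => 1 / Real.sqrt (x * (1 - x ^ 4))) (Set.Ioo 0 1) := by
  have hr : IntegrableOn (fun x : ℝ => x ^ (-(1 / 2) : ℝ)) (Set.Ioo 0 1) :=
    (intervalIntegral.integrableOn_Ioo_rpow_iff one_pos).2 (by norm_num)
  have hl : IntegrableOn (fun x : ℝ => (1 - x) ^ (-(1 / 2) : ℝ)) (Set.Ioo 0 1) := by
    have h := (intervalIntegral.intervalIntegrable_rpow' (a := 0) (b := 1)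
      (r := (-(1 / 2) : ℝ)) (by norm_num)).comp_sub_left 1
    simp only [sub_zero, sub_self] at h
    exact ((intervalIntegrable_iff_integrableOn_Ioo_of_le zero_le_one).1 h.symm)
  refine (hr.add hl).mono' (Measurable.aestronglyMeasurable (by fun_prop)) ?_
  filter_upwards [ae_restrict_mem measurableSet_Ioo] with x ⟨h0, h1⟩
  have h1' : 0 < 1 - x := sub_pos.2 h1
  have hle : x * (1 - x) ≤ x * (1 - x ^ 4) := by
    have : x ^ 4 ≤ x := pow_le_of_le_one h0.le h1.le (by norm_num)
    gcongr
  have hneg {y : ℝ} (hy : 0 < y) : y ^ (-(1 / 2) : ℝ) = 1 / Real.sqrt y := by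
    rw [Real.rpow_neg hy.le, Real.sqrt_eq_rpow, one_div, one_div]
  rw [Real.norm_of_nonneg (by positivity)]
  simp only [Pi.add_apply]
  rw [hneg h0, hneg h1']
  calc 1 / Real.sqrt (x * (1 - x ^ 4)) ≤ 1 / Real.sqrt (x * (1 - x)) := by gcongr
    _ ≤ 1 / Real.sqrt x + 1 / Real.sqrt (1 - x) := by
      have ha := Real.sqrt_pos.2 h0
      have hb := Real.sqrt_pos.2 h1'
      rw [Real.sqrt_mul h0.le, div_add_div _ _ ha.ne' hb.ne']
      gcongr
      nlinarith [Real.sq_sqrt h0.le, Real.sq_sqrt h1'.le]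

lemma integrableOn_div_sqrt_mul_one_sub_pow_four :
    IntegrableOn (fun x : ℝ => x / Real.sqrt (x * (1 - x ^ 4))) (Set.Ioo 0 1) := by
  refine integrableOn_one_div_sqrt_mul_one_sub_pow_four.mono' (Measurable.aestronglyMeasurable (by fun_prop)) ?_
  filter_upwards [ae_restrict_mem measurableSet_Ioo] with x ⟨h0, h1⟩
  rw [Real.norm_of_nonneg (by positivity)]
  gcongr

lemma setIntegral_linear_div_sqrt (a b : ℝ) :
    ∫ x in Set.Ioo (0 : ℝ) 1, (a * x + b) / Real.sqrt (x * (1 - x ^ 4))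
      = a * (∫ x in Set.Ioo (0 : ℝ) 1, x / Real.sqrt (x * (1 - x ^ 4)))
        + b * ∫ x in Set.Ioo (0 : ℝ) 1, 1 / Real.sqrt (x * (1 - x ^ 4)) := by
  rw [← integral_const_mul, ← integral_const_mul, ← integral_add
    (integrableOn_div_sqrt_mul_one_sub_pow_four.const_mul a)
    (integrableOn_one_div_sqrt_mul_one_sub_pow_four.const_mul b)]
  congr 1 with x
  ring

/-- The substitution `x ↦ 1 / x` carries `(0, 1)` to `(1, ∞)`. -/
lemma setIntegral_Ioi_eq_of_inv (c : ℝ) :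
    ∫ x in Set.Ioi (1 : ℝ), (x + c) / Real.sqrt (x * (x ^ 4 - 1))
      = ∫ x in Set.Ioo (0 : ℝ) 1, (c * x + 1) / Real.sqrt (x * (1 - x ^ 4)) := by
  have himage : (fun x : ℝ => x⁻¹) '' Set.Ioo 0 1 = Set.Ioi 1 := by
    ext y
    constructor
    · rintro ⟨x, ⟨h0, h1⟩, rfl⟩
      exact (one_lt_inv₀ h0).2 h1
    · intro hy
      have hy' : 1 < y := hy
      exact ⟨y⁻¹, ⟨by positivity, inv_lt_one_of_one_lt₀ hy'⟩, inv_inv y⟩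
  rw [← himage, integral_image_eq_integral_abs_deriv_smul measurableSet_Ioo
    (fun x hx => (hasDerivAt_inv hx.1.ne').hasDerivWithinAt) inv_injective.injOn]
  refine setIntegral_congr_fun measurableSet_Ioo fun x ⟨h0, h1⟩ => ?_
  have hw : 0 < x * (1 - x ^ 4) :=
    mul_pos h0 (sub_pos.2 (pow_lt_one₀ h0.le h1 (by norm_num)))
  have hs : Real.sqrt (x⁻¹ * (x⁻¹ ^ 4 - 1)) = Real.sqrt (x * (1 - x ^ 4)) / x ^ 3 := by
    rw [show x⁻¹ * (x⁻¹ ^ 4 - 1) = x * (1 - x ^ 4) / (x ^ 3) ^ 2 by field_simp,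
      Real.sqrt_div hw.le, Real.sqrt_sq (by positivity)]
  have := Real.sqrt_pos.2 hw
  simp only [smul_eq_mul]
  rw [hs, abs_neg, abs_of_pos (by positivity)]
  generalize Real.sqrt (x * (1 - x ^ 4)) = s at *
  field_simp
  ring

/-- The substitution `x ↦ (1 + x) / (1 - x)` carries `(0, 1)` to `(1, ∞)`. -/
lemma setIntegral_Ioi_eq_of_moebius (c : ℝ) :
    ∫ x in Set.Ioi (1 : ℝ), (x + c) / Real.sqrt (x * (x ^ 4 - 1))
      = ∫ x in Set.Ioo (0 : ℝ) 1,
        ((1 - c) / Real.sqrt 2 * x + (1 + c) / Real.sqrt 2) / Real.sqrt (x * (1 - x ^ 4)) := by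
  have himage : (fun x : ℝ => (1 + x) / (1 - x)) '' Set.Ioo 0 1 = Set.Ioi 1 := by
    ext y
    constructor
    · rintro ⟨x, ⟨h0, h1⟩, rfl⟩
      exact (one_lt_div (sub_pos.2 h1)).2 (by linarith)
    · intro hy
      have hy' : 1 < y := hy
      have : 0 < y + 1 := by linarith
      refine ⟨(y - 1) / (y + 1), ⟨div_pos (sub_pos.2 hy') this,
        (div_lt_one this).2 (by linarith)⟩, ?_⟩
      have h2 : 1 - (y - 1) / (y + 1) ≠ 0 := by
        field_simp
        simp [this.ne']
      simp only []
      rw [div_eq_iff h2]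
      field_simp
      ring
  have hderiv : ∀ x ∈ Set.Ioo (0 : ℝ) 1,
      HasDerivWithinAt (fun x : ℝ => (1 + x) / (1 - x)) (2 / (1 - x) ^ 2) (Set.Ioo 0 1) x := by
    intro x hx
    have h := (((hasDerivAt_id x).const_add 1).div ((hasDerivAt_id x).const_sub 1)
      (sub_pos.2 hx.2).ne').hasDerivWithinAt (s := Set.Ioo 0 1)
    refine h.congr_deriv ?_
    simp only [id]
    ring
  have hinj : Set.InjOn (fun x : ℝ => (1 + x) / (1 - x)) (Set.Ioo 0 1) := by
    intro x hx y hy h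
    have h' := (div_eq_div_iff (sub_pos.2 hx.2).ne' (sub_pos.2 hy.2).ne').1 h
    linarith
  rw [← himage, integral_image_eq_integral_abs_deriv_smul measurableSet_Ioo hderiv hinj]
  refine setIntegral_congr_fun measurableSet_Ioo fun x ⟨h0, h1⟩ => ?_
  have hw : 0 < x * (1 - x ^ 4) :=
    mul_pos h0 (sub_pos.2 (pow_lt_one₀ h0.le h1 (by norm_num)))
  have h1' : 0 < 1 - x := sub_pos.2 h1
  have hs : Real.sqrt ((1 + x) / (1 - x) * (((1 + x) / (1 - x)) ^ 4 - 1))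
      = 2 * Real.sqrt 2 * Real.sqrt (x * (1 - x ^ 4)) / (1 - x) ^ 3 := by
    rw [Real.sqrt_eq_iff_mul_self_eq_of_pos (by positivity)]
    have e : ∀ s t d : ℝ, 2 * s * t / d * (2 * s * t / d) = 4 * s ^ 2 * t ^ 2 / d ^ 2 := by
      intros; ring
    rw [e, Real.sq_sqrt zero_le_two, Real.sq_sqrt hw.le]
    field_simp
    ring
  have := Real.sqrt_pos.2 hw
  simp only [smul_eq_mul]
  rw [hs, abs_of_pos (by positivity)]
  generalize Real.sqrt (x * (1 - x ^ 4)) = s at *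
  field_simp
  ring

/-- The ratio of the two convergent improper integrals
`∫₀¹ (x+1+√2)/√(x(1−x⁴)) dx` and `∫₁^∞ (x+1+√2)/√(x(x⁴−1)) dx` equals `√2`. -/
theorem bolza_integral_ratio :
    (∫ x in (0:ℝ)..1, (x + 1 + Real.sqrt 2) / Real.sqrt (x * (1 - x ^ 4)))
      = Real.sqrt 2 *
        ∫ x in Set.Ioi (1:ℝ), (x + 1 + Real.sqrt 2) / Real.sqrt (x * (x ^ 4 - 1)) := by
  have hinv := setIntegral_Ioi_eq_of_inv (1 + Real.sqrt 2)
  have hmoeb := setIntegral_Ioi_eq_of_moebius (1 + Real.sqrt 2)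
  have hfin := setIntegral_linear_div_sqrt 1 (1 + Real.sqrt 2)
  rw [setIntegral_linear_div_sqrt] at hinv hmoeb
  simp only [one_mul, ← add_assoc] at hinv hmoeb hfin
  rw [intervalIntegral.integral_of_le zero_le_one, integral_Ioc_eq_integral_Ioo, hfin]
  have hs : Real.sqrt 2 * Real.sqrt 2 = 2 := Real.mul_self_sqrt zero_le_two
  have hpos : 0 < Real.sqrt 2 := by positivity
  have ha : (1 - (1 + Real.sqrt 2)) / Real.sqrt 2 = -1 := by
    field_simp
    ring
  have hb : (1 + 1 + Real.sqrt 2) / Real.sqrt 2 = 1 + Real.sqrt 2 := by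
    rw [div_eq_iff hpos.ne']
    linarith
  simp only [sub_add_eq_sub_sub] at ha hmoeb
  rw [ha, hb] at hmoeb
  generalize (∫ x in Set.Ioi (1:ℝ), (x + 1 + Real.sqrt 2) / Real.sqrt (x * (x ^ 4 - 1))) = I at *
  generalize (∫ x in Set.Ioo (0 : ℝ) 1, x / Real.sqrt (x * (1 - x ^ 4))) = A at *
  generalize (∫ x in Set.Ioo (0 : ℝ) 1, 1 / Real.sqrt (x * (1 - x ^ 4))) = B at *
  have hBA : B = (1 + Real.sqrt 2) * A := by
    refine mul_left_cancel₀ hpos.ne' ?_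
    linear_combination hinv - hmoeb - A * hs
  rw [hinv, hBA]
  linear_combination (-A) * hs
end

section
/- If k ∈ (0,1) satisfies 2√k/(1+k) = √2 − 1 (equivalently ((1+k)/(2√k))² = (√2+1)²), then 4K(k)/K'(k) = √2. -/
open MeasureTheory

/-- The integral `∫₀^∞ dx / √((x² + a²)(x² + b²))`, which is invariant under the
arithmetic-geometric mean step. -/
noncomputable def agmIntegral (a b : ℝ) : ℝ :=
  ∫ x in Set.Ioi (0:ℝ), 1 / Real.sqrt ((x ^ 2 + a ^ 2) * (x ^ 2 + b ^ 2))

theorem agmIntegral_mul (c a b : ℝ) (hc : 0 < c) :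
    agmIntegral (c * a) (c * b) = c⁻¹ * agmIntegral a b := by
  have h := integral_comp_mul_left_Ioi
    (fun x : ℝ => 1 / Real.sqrt ((x ^ 2 + (c * a) ^ 2) * (x ^ 2 + (c * b) ^ 2))) 0 hc
  have hs (x : ℝ) : 1 / Real.sqrt (((c * x) ^ 2 + (c * a) ^ 2) * ((c * x) ^ 2 + (c * b) ^ 2)) =
      (c ^ 2)⁻¹ * (1 / Real.sqrt ((x ^ 2 + a ^ 2) * (x ^ 2 + b ^ 2))) := by
    rw [show ((c * x) ^ 2 + (c * a) ^ 2) * ((c * x) ^ 2 + (c * b) ^ 2) =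
      (c ^ 2) ^ 2 * ((x ^ 2 + a ^ 2) * (x ^ 2 + b ^ 2)) by ring,
      Real.sqrt_mul (by positivity), Real.sqrt_sq (by positivity), one_div, mul_inv, one_div]
  simp only [hs, mul_zero, smul_eq_mul] at h
  rw [integral_const_mul] at h
  change _ * agmIntegral a b = _ * agmIntegral (c * a) (c * b) at h
  field_simp at h ⊢
  linarith

/-- Landen's transformation, through the substitution `u = (x - ab/x)/2`. -/
theorem agmIntegral_agm (a b : ℝ) (ha : 0 < a) (hb : 0 < b) :
    agmIntegral ((a + b) / 2) (Real.sqrt (a * b)) = agmIntegral a b := by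
  have hab : 0 < a * b := mul_pos ha hb
  set g : ℝ → ℝ := fun u =>
    1 / Real.sqrt ((u ^ 2 + ((a + b) / 2) ^ 2) * (u ^ 2 + Real.sqrt (a * b) ^ 2)) with hg
  set φ : ℝ → ℝ := fun x => (x - a * b / x) / 2 with hφ
  have hderiv : ∀ x ∈ Set.Ioi (0:ℝ),
      HasDerivWithinAt φ ((1 + a * b / x ^ 2) / 2) (Set.Ioi 0) x := by
    intro x hx
    have hx0 : x ≠ 0 := (Set.mem_Ioi.mp hx).ne'
    have h := ((hasDerivAt_id x).sub ((hasDerivAt_inv hx0).const_mul (a * b))).div_const 2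
    refine (h.congr_deriv ?_).hasDerivWithinAt
    field_simp
    ring
  have hinj : Set.InjOn φ (Set.Ioi 0) := by
    refine StrictMonoOn.injOn fun x hx y hy hxy => ?_
    have := div_lt_div_of_pos_left hab (Set.mem_Ioi.mp hx) hxy
    simp only [hφ]
    linarith
  have himage : φ '' Set.Ioi 0 = Set.univ := by
    refine Set.eq_univ_of_forall fun u => ?_
    have hlt : |u| < Real.sqrt (u ^ 2 + a * b) := by
      rw [← Real.sqrt_sq_eq_abs]
      exact Real.sqrt_lt_sqrt (sq_nonneg u) (by linarith)
    have hpos : 0 < u + Real.sqrt (u ^ 2 + a * b) := by linarith [neg_abs_le u]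
    have hsq := Real.sq_sqrt (show 0 ≤ u ^ 2 + a * b by positivity)
    refine ⟨u + Real.sqrt (u ^ 2 + a * b), hpos, ?_⟩
    simp only [hφ]
    field_simp
    linarith
  have hcv := integral_image_eq_integral_abs_deriv_smul measurableSet_Ioi hderiv hinj g
  have hpoint : ∀ x ∈ Set.Ioi (0:ℝ), |(1 + a * b / x ^ 2) / 2| • g (φ x) =
      2 * (1 / Real.sqrt ((x ^ 2 + a ^ 2) * (x ^ 2 + b ^ 2))) := by
    intro x hx
    have hx : 0 < x := hx
    have hfactor : (φ x ^ 2 + ((a + b) / 2) ^ 2) * (φ x ^ 2 + Real.sqrt (a * b) ^ 2) =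
        ((x ^ 2 + a * b) / (4 * x ^ 2)) ^ 2 * ((x ^ 2 + a ^ 2) * (x ^ 2 + b ^ 2)) := by
      rw [Real.sq_sqrt hab.le]
      simp only [hφ]
      field_simp
      ring
    have hroot : 0 < Real.sqrt ((x ^ 2 + a ^ 2) * (x ^ 2 + b ^ 2)) :=
      Real.sqrt_pos.mpr (by positivity)
    simp only [hg, smul_eq_mul]
    rw [hfactor, Real.sqrt_mul (by positivity), Real.sqrt_sq (by positivity),
      abs_of_pos (by positivity)]
    field_simp
    ring
  rw [setIntegral_congr_fun measurableSet_Ioi hpoint, himage, setIntegral_univ,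
    integral_const_mul] at hcv
  have heven : ∫ u, g u = 2 * ∫ u in Set.Ioi (0:ℝ), g u := by
    rw [← integral_comp_abs]
    simp only [hg, sq_abs]
  rw [heven] at hcv
  exact mul_left_cancel₀ two_ne_zero hcv

theorem agmIntegral_one_pos (b : ℝ) (hb : 0 < b) (hb1 : b ≤ 1) : 0 < agmIntegral 1 b := by
  have hint : IntegrableOn (fun x : ℝ => (1 + x ^ 2)⁻¹) (Set.Ioi 0) :=
    integrable_inv_one_add_sq.integrableOn
  have hupper (x : ℝ) : 1 / Real.sqrt ((x ^ 2 + 1 ^ 2) * (x ^ 2 + b ^ 2)) ≤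
      b⁻¹ * (1 + x ^ 2)⁻¹ := by
    rw [← mul_inv, ← one_div]
    refine one_div_le_one_div_of_le (by positivity) (Real.le_sqrt_of_sq_le ?_)
    have : b ^ 2 ≤ 1 := by nlinarith
    have : b ^ 2 * (1 + x ^ 2) ≤ x ^ 2 + b ^ 2 := by nlinarith [sq_nonneg x]
    nlinarith [sq_nonneg x]
  have hlower (x : ℝ) : (1 + x ^ 2)⁻¹ ≤
      1 / Real.sqrt ((x ^ 2 + 1 ^ 2) * (x ^ 2 + b ^ 2)) := by
    rw [← one_div]
    refine one_div_le_one_div_of_le (Real.sqrt_pos.mpr (by positivity))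
      (Real.sqrt_le_iff.mpr ⟨by positivity, ?_⟩)
    have : b ^ 2 ≤ 1 := by nlinarith
    nlinarith [sq_nonneg x]
  have hint' : IntegrableOn
      (fun x : ℝ => 1 / Real.sqrt ((x ^ 2 + 1 ^ 2) * (x ^ 2 + b ^ 2))) (Set.Ioi 0) := by
    refine Integrable.mono' (hint.const_mul b⁻¹)
      (by fun_prop : Measurable _).aestronglyMeasurable (ae_of_all _ fun x => ?_)
    rw [Real.norm_of_nonneg (by positivity)]
    exact hupper x
  calc 0 < ∫ x in Set.Ioi (0:ℝ), (1 + x ^ 2)⁻¹ := by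
        rw [integral_Ioi_inv_one_add_sq, Real.arctan_zero]
        linarith [Real.pi_pos]
    _ ≤ agmIntegral 1 b := setIntegral_mono hint hint' hlower

/-- The substitution `t = 1/√(1 + x²)` in the complete elliptic integral of parameter `m`. -/
theorem integral_elliptic_eq_agmIntegral (m : ℝ) (hm : m < 1) :
    ∫ t in (0:ℝ)..1, 1 / Real.sqrt ((1 - t ^ 2) * (1 - m * t ^ 2)) =
      agmIntegral 1 (Real.sqrt (1 - m)) := by
  set g : ℝ → ℝ := fun t => 1 / Real.sqrt ((1 - t ^ 2) * (1 - m * t ^ 2)) with hg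
  set φ : ℝ → ℝ := fun x => (Real.sqrt (1 + x ^ 2))⁻¹ with hφ
  have hderiv : ∀ x ∈ Set.Ioi (0:ℝ),
      HasDerivWithinAt φ (-(x / Real.sqrt (1 + x ^ 2) ^ 3)) (Set.Ioi 0) x := by
    intro x hx
    have hpos : 0 < 1 + x ^ 2 := by positivity
    have hroot : 0 < Real.sqrt (1 + x ^ 2) := Real.sqrt_pos.mpr hpos
    have h := ((((hasDerivAt_id x).pow 2).const_add 1).sqrt hpos.ne').inv hroot.ne'
    refine (h.congr_deriv ?_).hasDerivWithinAt
    simp only [id_eq, Pi.pow_apply]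
    field_simp
    norm_num
  have hinj : Set.InjOn φ (Set.Ioi 0) := by
    refine StrictAntiOn.injOn fun x hx y hy hxy => ?_
    have hx : 0 < x := hx
    exact inv_strictAnti₀ (Real.sqrt_pos.mpr (by positivity))
      (Real.sqrt_lt_sqrt (by positivity) (by gcongr))
  have himage : φ '' Set.Ioi 0 = Set.Ioo 0 1 := by
    ext t
    constructor
    · rintro ⟨x, hx, rfl⟩
      have hx : 0 < x := hx
      refine ⟨by positivity, inv_lt_one_of_one_lt₀ ?_⟩
      rw [Real.lt_sqrt (by norm_num)]
      nlinarith
    · rintro ⟨ht0, ht1⟩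
      have h1 : 1 < (t ^ 2)⁻¹ := (one_lt_inv₀ (by positivity)).mpr (by nlinarith)
      refine ⟨Real.sqrt ((t ^ 2)⁻¹ - 1), Real.sqrt_pos.mpr (by linarith), ?_⟩
      simp only [hφ]
      rw [Real.sq_sqrt (by linarith), add_sub_cancel, Real.sqrt_inv, Real.sqrt_sq ht0.le, inv_inv]
  have hcv := integral_image_eq_integral_abs_deriv_smul measurableSet_Ioi hderiv hinj g
  have hpoint : ∀ x ∈ Set.Ioi (0:ℝ), |-(x / Real.sqrt (1 + x ^ 2) ^ 3)| • g (φ x) =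
      1 / Real.sqrt ((x ^ 2 + 1 ^ 2) * (x ^ 2 + Real.sqrt (1 - m) ^ 2)) := by
    intro x hx
    have hx : 0 < x := hx
    have hm' : 0 < 1 - m := by linarith
    have hroot : 0 < Real.sqrt (1 + x ^ 2) := Real.sqrt_pos.mpr (by positivity)
    have hsq : Real.sqrt (1 + x ^ 2) ^ 2 = 1 + x ^ 2 := Real.sq_sqrt (by positivity)
    have hfactor : (1 - φ x ^ 2) * (1 - m * φ x ^ 2) =
        (x / (1 + x ^ 2)) ^ 2 * (x ^ 2 + (1 - m)) := by
      simp only [hφ, inv_pow, hsq]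
      field_simp
      ring
    simp only [hg, smul_eq_mul]
    rw [hfactor, Real.sqrt_mul (by positivity), Real.sqrt_sq (by positivity), abs_neg,
      abs_of_pos (by positivity), Real.sq_sqrt hm'.le, one_pow, add_comm (x ^ 2) 1,
      Real.sqrt_mul (by positivity), ← hsq]
    field_simp
    rw [Real.sqrt_sq hroot.le]
  rw [intervalIntegral.integral_of_le zero_le_one, integral_Ioc_eq_integral_Ioo, ← himage, hcv]
  exact setIntegral_congr_fun measurableSet_Ioi hpoint

/-- If `k ∈ (0,1)` satisfies `2√k/(1+k) = √2 − 1`, then `4K(k)/K'(k) = √2`. -/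
theorem edge_curve_modulus (k : ℝ) (hk : k ∈ Set.Ioo (0:ℝ) 1)
    (hstar : 2 * Real.sqrt k / (1 + k) = Real.sqrt 2 - 1) :
    4 * ellK k / ellK' k = Real.sqrt 2 := by
  obtain ⟨hk0, hk1⟩ := hk
  have h2 : Real.sqrt 2 ^ 2 = 2 := Real.sq_sqrt (by norm_num)
  have hl : 0 < Real.sqrt 2 - 1 := by
    rw [← hstar]
    positivity
  have hksq : Real.sqrt k ^ 2 = k := Real.sq_sqrt hk0.le
  set l' : ℝ := (1 - k) / (1 + k) with hl'
  have hl'pos : 0 < l' := div_pos (by linarith) (by linarith)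
  have hl'le : l' ≤ 1 := (div_le_one (by linarith)).mpr (by linarith)
  have hl'sq : l' ^ 2 = 1 - (Real.sqrt 2 - 1) ^ 2 := by
    rw [← hstar, hl', div_pow, div_pow, mul_pow, hksq]
    field_simp
    ring
  have hK : ellK k = (1 + k)⁻¹ * agmIntegral 1 l' := by
    rw [ellK, integral_elliptic_eq_agmIntegral _ (by nlinarith),
      ← agmIntegral_mul _ _ _ (by linarith), hl', mul_one, mul_div_cancel₀ _ (by positivity),
      ← agmIntegral_agm (1 + k) (1 - k) (by linarith) (by linarith)]
    congr 2 <;> ring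
  have hsing : agmIntegral 1 (Real.sqrt 2 - 1) = Real.sqrt 2 * agmIntegral 1 l' := by
    have hs : Real.sqrt 2 = (Real.sqrt 2 / 2)⁻¹ := by
      field_simp
      exact h2
    rw [← agmIntegral_agm _ _ one_pos hl]
    nth_rw 3 [hs]
    rw [← agmIntegral_mul _ _ _ (by positivity)]
    congr 1
    · ring
    · rw [Real.sqrt_eq_iff_mul_self_eq (by linarith) (by positivity)]
      nlinarith
  have hK' : ellK' k = ((1 + k) / 2)⁻¹ * (Real.sqrt 2 * agmIntegral 1 l') := by
    rw [ellK', integral_elliptic_eq_agmIntegral _ (by nlinarith), sub_sub_cancel,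
      Real.sqrt_sq hk0.le, ← agmIntegral_agm _ _ one_pos hk0, ← hsing,
      ← agmIntegral_mul _ _ _ (by positivity), ← hstar]
    congr 1
    · ring
    · rw [one_mul]
      field_simp
  have hpos := agmIntegral_one_pos l' hl'pos hl'le
  rw [hK, hK']
  field_simp
  linarith
end

section
/- Let h(z) = (1−z)/(1+z) and q(z) = (z+1+√2)²/(z(1−z⁴)), viewed as functions of a complex variable. Then the quadratic differential q(z)dz² is invariant under h: for every z ∈ ℂ with z ∉ {0, 1, −1, i, −i}, one has q(h(z)) · (h'(z))² = q(z), where h'(z) = −2/(1+z)². -/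
/-- The Möbius involution `h(z) = (1−z)/(1+z)`. -/
noncomputable def moebiusH (z : ℂ) : ℂ := (1 - z) / (1 + z)

/-- The quadratic differential coefficient `q(z) = (z+1+√2)²/(z(1−z⁴))`. -/
noncomputable def qEdge (z : ℂ) : ℂ :=
  (z + 1 + (Real.sqrt 2 : ℂ)) ^ 2 / (z * (1 - z ^ 4))

/-- The quadratic differential `q(z)dz²` is invariant under `h`: for every
`z ∉ {0, 1, −1, i, −i}`, one has `q(h(z))·(h'(z))² = q(z)` where `h'(z) = −2/(1+z)²`. -/
theorem qEdge_invariant (z : ℂ) (h0 : z ≠ 0) (h1 : z ≠ 1) (h2 : z ≠ -1)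
    (h3 : z ≠ Complex.I) (h4 : z ≠ -Complex.I) :
    qEdge (moebiusH z) * (-2 / (1 + z) ^ 2) ^ 2 = qEdge z := by
  have hs : (Real.sqrt 2 : ℂ) ^ 2 = 2 := by
    rw [← Complex.ofReal_pow, Real.sq_sqrt (by norm_num)]
    norm_num
  have hp : 1 + z ≠ 0 := fun h => h2 (by linear_combination h)
  have hm : 1 - z ≠ 0 := fun h => h1 (by linear_combination -h)
  have hq : 1 + z ^ 2 ≠ 0 := fun h => by
    have hI : (z - Complex.I) * (z + Complex.I) = 0 := by
      linear_combination h - Complex.I_sq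
    rcases mul_eq_zero.mp hI with h | h
    · exact h3 (sub_eq_zero.mp h)
    · exact h4 (eq_neg_of_add_eq_zero_left h)
  have hnum : (moebiusH z + 1 + (Real.sqrt 2 : ℂ)) ^ 2 =
      2 * (z + 1 + (Real.sqrt 2 : ℂ)) ^ 2 / (1 + z) ^ 2 := by
    have hlin : moebiusH z + 1 + (Real.sqrt 2 : ℂ) =
        (Real.sqrt 2 : ℂ) * (z + 1 + (Real.sqrt 2 : ℂ)) / (1 + z) := by
      unfold moebiusH
      rw [eq_div_iff hp, add_mul, add_mul, div_mul_cancel₀ _ hp]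
      linear_combination -hs
    rw [hlin, div_pow, mul_pow, hs]
  have hden : moebiusH z * (1 - moebiusH z ^ 4) =
      8 * z * (1 - z) * (1 + z ^ 2) / (1 + z) ^ 5 := by
    unfold moebiusH
    field_simp
    ring
  have hfac : z * (1 - z ^ 4) = z * (1 - z) * (1 + z) * (1 + z ^ 2) := by ring
  unfold qEdge
  rw [hnum, hden, hfac]
  field_simp
  ring
end

section
/- Fix k ∈ (0,1) and set k* = 2√k/(1+k). Let g(z) = ((1+k)/2)·(1+z)/(1+kz), ω(z) = 1/(4z(1−z)(1−(k*)²z)), and τ(z) = 1/((1−z²)(1−k²z²)). Then the pullback identity g*ω = ((1+k)/2)²·τ holds: for every z ∈ ℂ where both sides are defined (i.e. z ∉ {±1, ±1/k, −1} and g(z) ∉ {0, 1, 1/(k*)²}), one has ω(g(z))·(g'(z))² = ((1+k)/2)² · τ(z). -/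
/-- The Möbius transformation `g(z) = ((1+k)/2)·(1+z)/(1+kz)`. -/
noncomputable def gMob (k : ℝ) (z : ℂ) : ℂ :=
  ((1 + (k : ℂ)) / 2) * (1 + z) / (1 + (k : ℂ) * z)

/-- The quadratic differential coefficient `ω(z) = 1/(4z(1−z)(1−(k*)²z))`. -/
noncomputable def omegaQD (kstar : ℝ) (z : ℂ) : ℂ :=
  1 / (4 * z * (1 - z) * (1 - (kstar : ℂ) ^ 2 * z))

/-- The quadratic differential coefficient `τ(z) = 1/((1−z²)(1−k²z²))`. -/
noncomputable def tauQD (k : ℝ) (z : ℂ) : ℂ :=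
  1 / ((1 - z ^ 2) * (1 - (k : ℂ) ^ 2 * z ^ 2))

/-- For `k ∈ (0,1)` and `k* = 2√k/(1+k)`, the pullback identity `g*ω = ((1+k)/2)²·τ`
holds: wherever both sides are defined,
`ω(g(z))·(g'(z))² = ((1+k)/2)² · τ(z)`. -/
theorem pullback_identity (k : ℝ) (hk : k ∈ Set.Ioo (0:ℝ) 1) (z : ℂ)
    (hz1 : z ≠ 1) (hz2 : z ≠ -1) (hz3 : z ≠ 1 / (k : ℂ)) (hz4 : z ≠ -(1 / (k : ℂ)))
    (hg0 : gMob k z ≠ 0) (hg1 : gMob k z ≠ 1)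
    (hg2 : gMob k z ≠ 1 / ((2 * Real.sqrt k / (1 + k) : ℝ) : ℂ) ^ 2) :
    omegaQD (2 * Real.sqrt k / (1 + k)) (gMob k z) * (deriv (gMob k) z) ^ 2
      = ((1 + (k : ℂ)) / 2) ^ 2 * tauQD k z := by
  obtain ⟨hk0, hk1⟩ := hk
  have hkc : (k : ℂ) ≠ 0 := by exact_mod_cast hk0.ne'
  have h1k : 1 + (k : ℂ) ≠ 0 := by exact_mod_cast (by linarith : (1 + k : ℝ) ≠ 0)
  have hmk : 1 - (k : ℂ) ≠ 0 := by exact_mod_cast (by linarith : (1 - k : ℝ) ≠ 0)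
  have hden : 1 + (k : ℂ) * z ≠ 0 := fun h ↦ hz4 <| by
    field_simp
    linear_combination h
  have hden' : 1 - (k : ℂ) * z ≠ 0 := fun h ↦ hz3 <| by
    field_simp
    linear_combination -h
  have hz1' : 1 - z ≠ 0 := sub_ne_zero.2 hz1.symm
  have hz2' : 1 + z ≠ 0 := fun h ↦ hz2 (by linear_combination h)
  have hkstar : ((2 * Real.sqrt k / (1 + k) : ℝ) : ℂ) ^ 2 = 4 * k / (1 + k) ^ 2 := by
    rw [← Complex.ofReal_pow, div_pow, mul_pow, Real.sq_sqrt hk0.le]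
    push_cast
    norm_num
  have hderiv : deriv (gMob k) z = (1 + k) / 2 * (1 - k) / (1 + k * z) ^ 2 := by
    have h := (((hasDerivAt_id z).const_add 1).const_mul ((1 + (k : ℂ)) / 2)).div
      (((hasDerivAt_id z).const_mul (k : ℂ)).const_add 1) hden
    refine (h.congr_deriv ?_).deriv
    simp only [id_eq]
    ring
  have hone : 1 - gMob k z = (1 - k) * (1 - z) / (2 * (1 + k * z)) := by
    unfold gMob
    field_simp
    ring
  have hstar : 1 - 4 * k / (1 + k) ^ 2 * gMob k z
      = (1 - k) * (1 - k * z) / ((1 + k) * (1 + k * z)) := by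
    unfold gMob
    field_simp
    ring
  have htau : (1 - z ^ 2) * (1 - (k : ℂ) ^ 2 * z ^ 2)
      = (1 - z) * (1 + z) * ((1 - k * z) * (1 + k * z)) := by ring
  rw [omegaQD, tauQD, hkstar, hone, hstar, hderiv, htau, gMob]
  field_simp
  norm_num
end

section
/- Let s = √2 and let M be the 12×6 real matrix whose rows are: (−1−s, −1−s, −1, 0, −1−s, 1+s); (0, −1, −1−s, −1−s, 0, −3−2s); (1+s, −1−s, 3+2s, 0, 1+s, 1+s); (0, 3+2s, −1−s, 1+s, 0, 1); (0, 3+2s, −1−s, 1+s, 0, 1); (−3−2s, 0, 0, −3−2s, 1, 0); (0, −3−2s, 1+s, 1+s, 0, −1); (3+2s, 0, 0, 1, −1, 0); (−1−s, 1+s, 1, 0, −1−s, −1−s); (0, −3−2s, 1+s, 1+s, 0, −1); (1+s, 1+s, −3−2s, 0, 1+s, −1−s); (0, 1, 1+s, −1−s, 0, 3+2s). Then M has rank 6, i.e. the linear map ℝ⁶ → ℝ¹² given by v ↦ Mv is injective. -/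
open Matrix

/-- The 12×6 matrix of (rescaled) differentials of the extremal lengths of the twelve
edge curves of the punctured octahedron, with `s = √2`. -/
noncomputable def edgeMatrix : Matrix (Fin 12) (Fin 6) ℝ :=
  let s := Real.sqrt 2
  !![-1 - s, -1 - s, -1, 0, -1 - s, 1 + s;
     0, -1, -1 - s, -1 - s, 0, -3 - 2 * s;
     1 + s, -1 - s, 3 + 2 * s, 0, 1 + s, 1 + s;
     0, 3 + 2 * s, -1 - s, 1 + s, 0, 1;
     0, 3 + 2 * s, -1 - s, 1 + s, 0, 1;
     -3 - 2 * s, 0, 0, -3 - 2 * s, 1, 0;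
     0, -3 - 2 * s, 1 + s, 1 + s, 0, -1;
     3 + 2 * s, 0, 0, 1, -1, 0;
     -1 - s, 1 + s, 1, 0, -1 - s, -1 - s;
     0, -3 - 2 * s, 1 + s, 1 + s, 0, -1;
     1 + s, 1 + s, -3 - 2 * s, 0, 1 + s, -1 - s;
     0, 1, 1 + s, -1 - s, 0, 3 + 2 * s]

/-- The kernel of `edgeMatrix` is trivial. -/
lemma eq_zero_of_edgeMatrix_mulVec_eq_zero {v : Fin 6 → ℝ} (hv : edgeMatrix *ᵥ v = 0) :
    v = 0 := by
  have hs : 0 ≤ √(2 : ℝ) := Real.sqrt_nonneg 2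
  have h0 := congrFun hv 0
  have h1 := congrFun hv 1
  have h2 := congrFun hv 2
  have h5 := congrFun hv 5
  have h7 := congrFun hv 7
  have h8 := congrFun hv 8
  simp only [edgeMatrix, mulVec, dotProduct, Fin.sum_univ_six, of_apply, cons_val,
    Pi.zero_apply] at h0 h1 h2 h5 h7 h8
  generalize √(2 : ℝ) = s at *
  have e04 : v 0 + v 4 = 0 := by
    have : (1 + s) * (v 0 + v 4) = 0 := by linear_combination (-1 / 2) * h0 - (1 / 2) * h8
    exact (mul_eq_zero.mp this).resolve_left (by positivity)
  have e2 : v 2 = 0 := by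
    have : (4 + 2 * s) * v 2 = 0 := by
      linear_combination h2 + (1 / 2) * (h8 - h0) - (1 + s) * e04
    exact (mul_eq_zero.mp this).resolve_left (by positivity)
  have e15 : v 1 - v 5 = 0 := by
    have : (1 + s) * (v 1 - v 5) = 0 := by linear_combination (1 / 2) * (h8 - h0) - e2
    exact (mul_eq_zero.mp this).resolve_left (by positivity)
  have e3 : v 3 = 0 := by
    have : (2 + 2 * s) * v 3 = 0 := by linear_combination -h5 - h7
    exact (mul_eq_zero.mp this).resolve_left (by positivity)
  have e0 : v 0 = 0 := by
    have : (4 + 2 * s) * v 0 = 0 := by linear_combination h7 + e04 - e3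
    exact (mul_eq_zero.mp this).resolve_left (by positivity)
  have e5 : v 5 = 0 := by
    have : (4 + 2 * s) * v 5 = 0 := by
      linear_combination -h1 - e15 - (1 + s) * e2 - (1 + s) * e3
    exact (mul_eq_zero.mp this).resolve_left (by positivity)
  ext i
  fin_cases i
  · exact e0
  · exact (sub_eq_zero.mp e15).trans e5
  · exact e2
  · exact e3
  · simpa [e0] using e04
  · exact e5

/-- The matrix `edgeMatrix` has rank 6; equivalently, the linear map
`v ↦ Mv` from `ℝ⁶` to `ℝ¹²` is injective. This is the perfection of the Bolza
surface for the extremal length systole. -/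
theorem edgeMatrix_rank :
    edgeMatrix.rank = 6 ∧ Function.Injective edgeMatrix.mulVec := by
  have hinj : Function.Injective edgeMatrix.mulVec := by
    intro v w h
    exact sub_eq_zero.mp (eq_zero_of_edgeMatrix_mulVec_eq_zero (by
      rw [mulVec_sub]; exact sub_eq_zero.mpr h))
  refine ⟨?_, hinj⟩
  have h := LinearMap.finrank_range_of_inj (f := edgeMatrix.mulVecLin) hinj
  simpa [Matrix.rank] using h
end

section
/- Let u = √(2+√2)/2, so that the complementary modulus is u' = √(1−u²) = √(2−√2)/2. Then the ratio 4K(u)/K(u') lies in the interval [5.8768721265012 − 1.18·10⁻¹⁴, 5.8768721265012 + 1.18·10⁻¹⁴]. -/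
open MeasureTheory

open Real Set

/-- The integral of `1 / √((x² + a²) (x² + b²))` over the real line, which equals
`π / agm a b` for positive `a`, `b`. -/
noncomputable def lineIntegral (a b : ℝ) : ℝ :=
  ∫ x : ℝ, 1 / √((x ^ 2 + a ^ 2) * (x ^ 2 + b ^ 2))

theorem lineIntegral_eq_two_mul (a b : ℝ) :
    lineIntegral a b = 2 * ∫ x in Ioi (0 : ℝ), 1 / √((x ^ 2 + a ^ 2) * (x ^ 2 + b ^ 2)) := by
  rw [lineIntegral,
    ← integral_comp_abs (f := fun x : ℝ => 1 / √((x ^ 2 + a ^ 2) * (x ^ 2 + b ^ 2)))]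
  congr 1 with x
  rw [sq_abs]

theorem integral_one_div_sq_add_sq {m : ℝ} (hm : 0 < m) :
    ∫ x : ℝ, 1 / (x ^ 2 + m ^ 2) = π / m := by
  have h := Measure.integral_comp_div (fun x : ℝ => (1 + x ^ 2)⁻¹) m
  rw [integral_univ_inv_one_add_sq, abs_of_pos hm, smul_eq_mul] at h
  have hfun : (fun x : ℝ => 1 / (x ^ 2 + m ^ 2)) =
      fun x => (m ^ 2)⁻¹ * (1 + (x / m) ^ 2)⁻¹ := by
    funext x
    field_simp
    ring
  rw [hfun, integral_const_mul, h]
  field_simp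

theorem integrable_one_div_sq_add_sq {m : ℝ} (hm : 0 < m) :
    Integrable fun x : ℝ => 1 / (x ^ 2 + m ^ 2) := by
  refine Integrable.of_integral_ne_zero ?_
  rw [integral_one_div_sq_add_sq hm]
  positivity

theorem sq_add_sq_le_sqrt_mul {m a b : ℝ} (hm : 0 ≤ m) (ha : m ≤ a) (hb : m ≤ b) (x : ℝ) :
    x ^ 2 + m ^ 2 ≤ √((x ^ 2 + a ^ 2) * (x ^ 2 + b ^ 2)) := by
  apply Real.le_sqrt_of_sq_le
  rw [sq (x ^ 2 + m ^ 2)]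
  gcongr

theorem integrable_one_div_sqrt_mul {a b : ℝ} (ha : 0 < a) (hb : 0 < b) :
    Integrable fun x : ℝ => 1 / √((x ^ 2 + a ^ 2) * (x ^ 2 + b ^ 2)) := by
  have hm : 0 < min a b := lt_min ha hb
  refine (integrable_one_div_sq_add_sq hm).mono' ?_ (.of_forall fun x => ?_)
  · refine (Continuous.div continuous_const (by fun_prop) fun x => ?_).aestronglyMeasurable
    positivity
  · rw [Real.norm_of_nonneg (by positivity)]
    exact one_div_le_one_div_of_le (by positivity)
      (sq_add_sq_le_sqrt_mul hm.le (min_le_left a b) (min_le_right a b) x)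

theorem lineIntegral_pos {a b : ℝ} (ha : 0 < a) (hb : 0 < b) : 0 < lineIntegral a b := by
  refine (integral_pos_iff_support_of_nonneg (fun x => by positivity)
    (integrable_one_div_sqrt_mul ha hb)).2 ?_
  have hs : (Function.support fun x : ℝ => 1 / √((x ^ 2 + a ^ 2) * (x ^ 2 + b ^ 2))) = univ :=
    eq_univ_of_forall fun x => by
      rw [Function.mem_support]
      positivity
  rw [hs]
  simp

theorem lineIntegral_anti {a b a' b' : ℝ} (ha : 0 < a) (hb : 0 < b) (haa : a ≤ a')
    (hbb : b ≤ b') : lineIntegral a' b' ≤ lineIntegral a b := by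
  refine integral_mono (integrable_one_div_sqrt_mul (ha.trans_le haa) (hb.trans_le hbb))
    (integrable_one_div_sqrt_mul ha hb) fun x => ?_
  dsimp only
  gcongr

theorem lineIntegral_self {m : ℝ} (hm : 0 < m) : lineIntegral m m = π / m := by
  rw [← integral_one_div_sq_add_sq hm, lineIntegral]
  congr 1 with x
  rw [Real.sqrt_mul_self (by positivity)]

theorem lineIntegral_le_pi_div {m a b : ℝ} (hm : 0 < m) (ha : m ≤ a) (hb : m ≤ b) :
    lineIntegral a b ≤ π / m :=
  (lineIntegral_anti hm hm ha hb).trans_eq (lineIntegral_self hm)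

theorem pi_div_le_lineIntegral {m a b : ℝ} (ha₀ : 0 < a) (hb₀ : 0 < b) (ha : a ≤ m)
    (hb : b ≤ m) : π / m ≤ lineIntegral a b :=
  (lineIntegral_self (ha₀.trans_le ha)).symm.trans_le (lineIntegral_anti ha₀ hb₀ ha hb)

/-- The arithmetic-geometric mean step (Gauss), by the substitution `y = (x - ab/x) / 2`. -/
theorem lineIntegral_mean {a b g : ℝ} (ha : 0 < a) (hb : 0 < b) (hg : g ^ 2 = a * b) :
    lineIntegral ((a + b) / 2) g = lineIntegral a b := by
  set φ : ℝ → ℝ := fun x => (x - a * b / x) / 2 with hφ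
  have hab : 0 < a * b := mul_pos ha hb
  have hderiv : ∀ x ∈ Ioi (0 : ℝ),
      HasDerivWithinAt φ ((1 + a * b / x ^ 2) / 2) (Ioi 0) x := by
    intro x hx
    have hx0 : x ≠ 0 := (mem_Ioi.1 hx).ne'
    have h := (((hasDerivAt_id x).sub ((hasDerivAt_inv hx0).const_mul (a * b))).div_const
      2).hasDerivWithinAt (s := Ioi 0)
    refine h.congr_deriv ?_
    field_simp
    ring
  have hinj : InjOn φ (Ioi 0) := by
    intro x hx y hy hxy
    have hx0 : 0 < x := hx
    have hy0 : 0 < y := hy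
    simp only [hφ] at hxy
    field_simp at hxy
    have h : (x - y) * (x * y + a * b) = 0 := by linear_combination hxy
    rcases mul_eq_zero.1 h with h | h
    · linarith
    · exact absurd h (by positivity)
  have himage : φ '' Ioi 0 = univ := by
    refine eq_univ_of_forall fun y => ?_
    have hs : √(y ^ 2 + a * b) ^ 2 = y ^ 2 + a * b := Real.sq_sqrt (by positivity)
    have hpos : 0 < y + √(y ^ 2 + a * b) := by
      have h : |y| < √(y ^ 2 + a * b) := Real.lt_sqrt_of_sq_lt (by rw [sq_abs]; linarith)
      linarith [neg_abs_le y]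
    refine ⟨y + √(y ^ 2 + a * b), hpos, ?_⟩
    simp only [hφ]
    field_simp
    linear_combination hs
  have key := integral_image_eq_integral_abs_deriv_smul measurableSet_Ioi hderiv hinj
    fun y => 1 / √((y ^ 2 + ((a + b) / 2) ^ 2) * (y ^ 2 + g ^ 2))
  rw [himage, setIntegral_univ] at key
  rw [lineIntegral_eq_two_mul a b, lineIntegral, key, ← integral_const_mul]
  refine setIntegral_congr_fun measurableSet_Ioi fun x hx => ?_
  have hx0 : 0 < x := hx
  have hprod : (φ x ^ 2 + ((a + b) / 2) ^ 2) * (φ x ^ 2 + g ^ 2) =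
      ((x + a * b / x) / (4 * x)) ^ 2 * ((x ^ 2 + a ^ 2) * (x ^ 2 + b ^ 2)) := by
    simp only [hφ, hg]
    field_simp
    ring
  have hne : √((x ^ 2 + a ^ 2) * (x ^ 2 + b ^ 2)) ≠ 0 := by positivity
  rw [hprod, Real.sqrt_mul (by positivity), Real.sqrt_sq (by positivity),
    abs_of_pos (by positivity), smul_eq_mul]
  field_simp
  ring

theorem lineIntegral_step_le {a b a' b' : ℝ} (ha : 0 < a) (hb : 0 < b) (ha' : 0 < a')
    (hb' : 0 < b') (haa : a' ≤ (a + b) / 2) (hbb : b' ^ 2 ≤ a * b) :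
    lineIntegral a b ≤ lineIntegral a' b' := by
  rw [← lineIntegral_mean ha hb (Real.sq_sqrt (mul_pos ha hb).le)]
  exact lineIntegral_anti ha' hb' haa (Real.le_sqrt_of_sq_le hbb)

theorem le_lineIntegral_step {a b a' b' : ℝ} (ha : 0 < a) (hb : 0 < b) (haa : (a + b) / 2 ≤ a')
    (hb' : 0 ≤ b') (hbb : a * b ≤ b' ^ 2) :
    lineIntegral a' b' ≤ lineIntegral a b := by
  rw [← lineIntegral_mean ha hb (Real.sq_sqrt (mul_pos ha hb).le)]
  exact lineIntegral_anti (by positivity) (by positivity) haa ((Real.sqrt_le_left hb').2 hbb)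

/-- The substitution `t = 1 / √(1 + x²)` in the complete elliptic integral. -/
theorem ellK_eq_lineIntegral {k k' : ℝ} (hk : k ^ 2 + k' ^ 2 = 1) :
    ellK k = lineIntegral 1 k' / 2 := by
  set φ : ℝ → ℝ := fun x => (√(1 + x ^ 2))⁻¹ with hφ
  have hderiv : ∀ x ∈ Ioi (0 : ℝ),
      HasDerivWithinAt φ (-(x / √(1 + x ^ 2) ^ 3)) (Ioi 0) x := by
    intro x hx
    have hpos : 0 < 1 + x ^ 2 := by positivity
    have h := ((((hasDerivAt_pow 2 x).const_add 1).sqrt hpos.ne').inv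
      (Real.sqrt_pos.2 hpos).ne').hasDerivWithinAt (s := Ioi 0)
    refine h.congr_deriv ?_
    field_simp
    norm_num
  have hinj : InjOn φ (Ioi 0) := by
    intro x hx y hy hxy
    have h := inv_injective hxy
    rw [Real.sqrt_inj (by positivity) (by positivity)] at h
    exact (pow_left_inj₀ (le_of_lt hx) (le_of_lt hy) two_ne_zero).1 (by linarith)
  have himage : φ '' Ioi 0 = Ioo 0 1 := by
    ext t
    constructor
    · rintro ⟨x, hx, rfl⟩
      have hx0 : 0 < x := hx
      refine ⟨by positivity, inv_lt_one_of_one_lt₀ (Real.lt_sqrt_of_sq_lt ?_)⟩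
      nlinarith
    · rintro ⟨h0, h1⟩
      have hpos : 0 < (t ^ 2)⁻¹ - 1 :=
        sub_pos.2 ((one_lt_inv₀ (by positivity)).2 (by nlinarith))
      refine ⟨√((t ^ 2)⁻¹ - 1), Real.sqrt_pos.2 hpos, ?_⟩
      simp only [hφ]
      rw [Real.sq_sqrt hpos.le, add_sub_cancel, Real.sqrt_inv, Real.sqrt_sq h0.le, inv_inv]
  have key := integral_image_eq_integral_abs_deriv_smul measurableSet_Ioi hderiv hinj
    fun t => 1 / √((1 - t ^ 2) * (1 - k ^ 2 * t ^ 2))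
  rw [himage] at key
  rw [lineIntegral_eq_two_mul, mul_div_cancel_left₀ _ two_ne_zero, ellK,
    intervalIntegral.integral_of_le zero_le_one, integral_Ioc_eq_integral_Ioo, key]
  refine setIntegral_congr_fun measurableSet_Ioi fun x hx => ?_
  have hx0 : 0 < x := hx
  have hs : √(1 + x ^ 2) ^ 2 = 1 + x ^ 2 := Real.sq_sqrt (by positivity)
  have hprod : (1 - φ x ^ 2) * (1 - k ^ 2 * φ x ^ 2) =
      (x / √(1 + x ^ 2) ^ 2) ^ 2 * ((x ^ 2 + 1 ^ 2) * (x ^ 2 + k' ^ 2))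
        / (1 + x ^ 2) := by
    have hk' : k ^ 2 = 1 - k' ^ 2 := by linarith
    simp only [hφ, inv_pow, hs, hk']
    field_simp
    ring
  rw [hprod, Real.sqrt_div (by positivity), Real.sqrt_mul (by positivity),
    Real.sqrt_sq (by positivity), abs_neg, abs_of_pos (by positivity), smul_eq_mul]
  have hne : √((x ^ 2 + 1 ^ 2) * (x ^ 2 + k' ^ 2)) ≠ 0 := by positivity
  field_simp

theorem lineIntegral_one_cos_pi_div_eight_le {b : ℝ} (hb : 0.9238795325112867561281 ≤ b) :
    lineIntegral 1 b ≤ π / 0.9615631078831995296924 := by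
  refine (lineIntegral_anti one_pos (by norm_num) le_rfl hb).trans ?_
  refine (lineIntegral_step_le (a' := 0.9619397662556433780640) (b' := 0.9611865232676157097223)
    (by norm_num) (by norm_num) (by norm_num) (by norm_num) (by norm_num) (by norm_num)).trans ?_
  refine (lineIntegral_step_le (a' := 0.9615631447616295438931) (b' := 0.9615630710047702226835)
    (by norm_num) (by norm_num) (by norm_num) (by norm_num) (by norm_num) (by norm_num)).trans ?_
  refine (lineIntegral_step_le (a' := 0.9615631078831998832883) (b' := 0.9615631078831991760967)
    (by norm_num) (by norm_num) (by norm_num) (by norm_num) (by norm_num) (by norm_num)).trans ?_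
  refine (lineIntegral_step_le (a' := 0.9615631078831995296925) (b' := 0.9615631078831995296924)
    (by norm_num) (by norm_num) (by norm_num) (by norm_num) (by norm_num) (by norm_num)).trans ?_
  exact lineIntegral_le_pi_div (by norm_num) (by norm_num) (by norm_num)

theorem le_lineIntegral_one_cos_pi_div_eight {b : ℝ} (hb₀ : 0 < b)
    (hb : b ≤ 0.9238795325112867561282) :
    π / 0.9615631078831995296928 ≤ lineIntegral 1 b := by
  refine le_trans ?_ (lineIntegral_anti one_pos hb₀ le_rfl hb)
  refine le_trans ?_ (le_lineIntegral_step
    (a' := 0.9619397662556433780641) (b' := 0.9611865232676157097225)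
    (by norm_num) (by norm_num) (by norm_num) (by norm_num) (by norm_num))
  refine le_trans ?_ (le_lineIntegral_step
    (a' := 0.9615631447616295438933) (b' := 0.9615630710047702226837)
    (by norm_num) (by norm_num) (by norm_num) (by norm_num) (by norm_num))
  refine le_trans ?_ (le_lineIntegral_step
    (a' := 0.9615631078831998832885) (b' := 0.9615631078831991760970)
    (by norm_num) (by norm_num) (by norm_num) (by norm_num) (by norm_num))
  refine le_trans ?_ (le_lineIntegral_step
    (a' := 0.9615631078831995296928) (b' := 0.9615631078831995296928)
    (by norm_num) (by norm_num) (by norm_num) (by norm_num) (by norm_num))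
  exact pi_div_le_lineIntegral (by norm_num) (by norm_num) (by norm_num) (by norm_num)

theorem lineIntegral_one_sin_pi_div_eight_le {b : ℝ} (hb : 0.3826834323650897717284 ≤ b) :
    lineIntegral 1 b ≤ π / 0.6544727107790017458796 := by
  refine (lineIntegral_anti one_pos (by norm_num) le_rfl hb).trans ?_
  refine (lineIntegral_step_le (a' := 0.6913417161825448858642) (b' := 0.6186141223453355431232)
    (by norm_num) (by norm_num) (by norm_num) (by norm_num) (by norm_num) (by norm_num)).trans ?_
  refine (lineIntegral_step_le (a' := 0.6549779192639402144937) (b' := 0.6539676972121658726907)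
    (by norm_num) (by norm_num) (by norm_num) (by norm_num) (by norm_num) (by norm_num)).trans ?_
  refine (lineIntegral_step_le (a' := 0.6544728082380530435922) (b' := 0.6544726133199577045934)
    (by norm_num) (by norm_num) (by norm_num) (by norm_num) (by norm_num) (by norm_num)).trans ?_
  refine (lineIntegral_step_le (a' := 0.6544727107790053740928) (b' := 0.6544727107789981176665)
    (by norm_num) (by norm_num) (by norm_num) (by norm_num) (by norm_num) (by norm_num)).trans ?_
  refine (lineIntegral_step_le (a' := 0.6544727107790017458796) (b' := 0.6544727107790017458796)
    (by norm_num) (by norm_num) (by norm_num) (by norm_num) (by norm_num) (by norm_num)).trans ?_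
  exact lineIntegral_le_pi_div (by norm_num) (by norm_num) (by norm_num)

theorem le_lineIntegral_one_sin_pi_div_eight {b : ℝ} (hb₀ : 0 < b)
    (hb : b ≤ 0.3826834323650897717285) :
    π / 0.6544727107790017458800 ≤ lineIntegral 1 b := by
  refine le_trans ?_ (lineIntegral_anti one_pos hb₀ le_rfl hb)
  refine le_trans ?_ (le_lineIntegral_step
    (a' := 0.6913417161825448858643) (b' := 0.6186141223453355431234)
    (by norm_num) (by norm_num) (by norm_num) (by norm_num) (by norm_num))
  refine le_trans ?_ (le_lineIntegral_step
    (a' := 0.6549779192639402144939) (b' := 0.6539676972121658726909)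
    (by norm_num) (by norm_num) (by norm_num) (by norm_num) (by norm_num))
  refine le_trans ?_ (le_lineIntegral_step
    (a' := 0.6544728082380530435924) (b' := 0.6544726133199577045937)
    (by norm_num) (by norm_num) (by norm_num) (by norm_num) (by norm_num))
  refine le_trans ?_ (le_lineIntegral_step
    (a' := 0.6544727107790053740931) (b' := 0.6544727107789981176668)
    (by norm_num) (by norm_num) (by norm_num) (by norm_num) (by norm_num))
  refine le_trans ?_ (le_lineIntegral_step
    (a' := 0.6544727107790017458800) (b' := 0.6544727107790017458800)
    (by norm_num) (by norm_num) (by norm_num) (by norm_num) (by norm_num))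
  exact pi_div_le_lineIntegral (by norm_num) (by norm_num) (by norm_num) (by norm_num)

/-- For `u = √(2+√2)/2` and `u' = √(2−√2)/2`, the extremal length `4K(u)/K(u')`
of an altitude curve lies in `[5.8768721265012 ± 1.18·10⁻¹⁴]`. -/
theorem altitude_curve_value :
    4 * ellK (Real.sqrt (2 + Real.sqrt 2) / 2) / ellK (Real.sqrt (2 - Real.sqrt 2) / 2)
      ∈ Set.Icc ((5.8768721265012 : ℝ) - 1.18 * 10 ^ (-14 : ℤ))
          ((5.8768721265012 : ℝ) + 1.18 * 10 ^ (-14 : ℤ)) := by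
  have hlo : (1.4142135623730950488016887242096 : ℝ) ≤ √2 :=
    Real.le_sqrt_of_sq_le (by norm_num)
  have hhi : √2 ≤ (1.4142135623730950488016887242097 : ℝ) :=
    (Real.sqrt_le_left (by norm_num)).2 (by norm_num)
  set u := √(2 + √2) / 2 with hu
  set v := √(2 - √2) / 2 with hv
  have hu2 : u ^ 2 = (2 + √2) / 4 := by
    rw [hu, div_pow, Real.sq_sqrt (by positivity)]
    norm_num
  have hv2 : v ^ 2 = (2 - √2) / 4 := by
    rw [hv, div_pow, Real.sq_sqrt (by linarith)]
    norm_num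
  have hu₀ : 0 ≤ u := by positivity
  have hv₀ : 0 ≤ v := by positivity
  have hul : 0.9238795325112867561281 ≤ u :=
    (pow_le_pow_iff_left₀ (by norm_num) hu₀ two_ne_zero).1 (by rw [hu2]; linarith)
  have huu : u ≤ 0.9238795325112867561282 :=
    (pow_le_pow_iff_left₀ hu₀ (by norm_num) two_ne_zero).1 (by rw [hu2]; linarith)
  have hvl : 0.3826834323650897717284 ≤ v :=
    (pow_le_pow_iff_left₀ (by norm_num) hv₀ two_ne_zero).1 (by rw [hv2]; linarith)
  have hvu : v ≤ 0.3826834323650897717285 :=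
    (pow_le_pow_iff_left₀ hv₀ (by norm_num) two_ne_zero).1 (by rw [hv2]; linarith)
  rw [ellK_eq_lineIntegral (k := u) (k' := v) (by rw [hu2, hv2]; ring),
    ellK_eq_lineIntegral (k := v) (k' := u) (by rw [hu2, hv2]; ring)]
  have hUl := le_lineIntegral_one_cos_pi_div_eight (by linarith) huu
  have hUu := lineIntegral_one_cos_pi_div_eight_le hul
  have hVl := le_lineIntegral_one_sin_pi_div_eight (by linarith) hvu
  have hVu := lineIntegral_one_sin_pi_div_eight_le hvl
  have hpos := lineIntegral_pos one_pos (show 0 < u by linarith)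
  have hpi := Real.pi_pos
  have hratio : 4 * (lineIntegral 1 v / 2) / (lineIntegral 1 u / 2) =
      4 * lineIntegral 1 v / lineIntegral 1 u := by
    field_simp
  rw [hratio]
  constructor
  · rw [le_div_iff₀ hpos]
    refine (mul_le_mul_of_nonneg_left hUu (by norm_num)).trans ?_
    refine le_trans ?_ (mul_le_mul_of_nonneg_left hVl (by norm_num))
    rw [div_eq_mul_inv, div_eq_mul_inv, ← mul_assoc, ← mul_assoc, mul_right_comm,
      mul_right_comm 4]
    exact mul_le_mul_of_nonneg_right (by norm_num) hpi.le
  · rw [div_le_iff₀ hpos]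
    refine (mul_le_mul_of_nonneg_left hVu (by norm_num)).trans ?_
    refine le_trans ?_ (mul_le_mul_of_nonneg_left hUl (by norm_num))
    rw [div_eq_mul_inv, div_eq_mul_inv, ← mul_assoc, ← mul_assoc, mul_right_comm,
      mul_right_comm _ π]
    exact mul_le_mul_of_nonneg_right (by norm_num) hpi.le
end

section
/- Let v = 1/√(27+15√3). Then 6K(v)/K'(v) < 2√2, i.e. the extremal length of a face curve of the punctured octahedron is strictly smaller than the extremal length 2√2 of an edge curve. -/
open MeasureTheory

open Real Set in
theorem integrableOn_one_div_sqrt_one_sub_sq :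
    IntegrableOn (fun t : ℝ => 1 / √(1 - t ^ 2)) (Icc 0 1) := by
  rw [integrableOn_Icc_iff_integrableOn_Ioc]
  refine intervalIntegral.integrableOn_deriv_of_nonneg (g := arcsin)
    continuous_arcsin.continuousOn (fun x hx => ?_) (fun x _ => by positivity)
  exact hasDerivAt_arcsin (by linarith [hx.1]) (by linarith [hx.2])

open Real Set in
theorem one_div_sqrt_mul_le {m t : ℝ} (hm : 0 ≤ m) (hm1 : m < 1) (ht : t ∈ Icc (0 : ℝ) 1) :
    1 / √((1 - t ^ 2) * (1 - m * t ^ 2)) ≤ 1 / √(1 - m) * (1 / √(1 - t ^ 2)) := by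
  have ht2 : t ^ 2 ≤ 1 := pow_le_one₀ ht.1 ht.2
  rw [sqrt_mul (by linarith), ← one_div_mul_one_div, mul_comm]
  have : √(1 - m) ≤ √(1 - m * t ^ 2) := sqrt_le_sqrt (by nlinarith)
  have : 0 < √(1 - m) := sqrt_pos.2 (by linarith)
  gcongr

open Real Set in
theorem integrableOn_one_div_sqrt_mul {m : ℝ} (hm : 0 ≤ m) (hm1 : m < 1) :
    IntegrableOn (fun t : ℝ => 1 / √((1 - t ^ 2) * (1 - m * t ^ 2))) (Icc 0 1) := by
  refine Integrable.mono' (integrableOn_one_div_sqrt_one_sub_sq.const_mul (1 / √(1 - m)))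
    (Measurable.aestronglyMeasurable (by fun_prop)) ?_
  filter_upwards [ae_restrict_mem measurableSet_Icc] with t ht
  rw [norm_of_nonneg (by positivity)]
  exact one_div_sqrt_mul_le hm hm1 ht

open Real Set in
theorem ellK_le {k : ℝ} (hk : k ^ 2 < 1) : ellK k ≤ π / 2 / √(1 - k ^ 2) := by
  have h := intervalIntegral.integral_le_sub_of_hasDeriv_right_of_le zero_le_one
    (g := fun t => 1 / √(1 - k ^ 2) * arcsin t)
    (g' := fun t => 1 / √(1 - k ^ 2) * (1 / √(1 - t ^ 2)))
    (by fun_prop)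
    (fun x hx => ((hasDerivAt_arcsin (by linarith [hx.1])
      (by linarith [hx.2])).const_mul _).hasDerivWithinAt)
    (integrableOn_one_div_sqrt_mul (sq_nonneg k) hk)
    (fun x hx => one_div_sqrt_mul_le (sq_nonneg k) hk (Ioo_subset_Icc_self hx))
  simp only [arcsin_one, arcsin_zero, mul_zero, sub_zero] at h
  exact h.trans_eq (by ring)

/-- A primitive of `x ↦ (1 - x² / 2) / √(x² + k²)`, which bounds
`1 / √((1 + x²) (x² + k²))` from below. -/
noncomputable def lowerPrimitive (k x : ℝ) : ℝ :=
  (1 + k ^ 2 / 4) * Real.arsinh (x / k) - x * √(x ^ 2 + k ^ 2) / 4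

open Real in
theorem hasDerivAt_lowerPrimitive {k : ℝ} (hk : 0 < k) (x : ℝ) :
    HasDerivAt (lowerPrimitive k) ((1 - x ^ 2 / 2) / √(x ^ 2 + k ^ 2)) x := by
  have hs : 0 < √(x ^ 2 + k ^ 2) := sqrt_pos.2 (by positivity)
  have hsq : √(x ^ 2 + k ^ 2) ^ 2 = x ^ 2 + k ^ 2 := sq_sqrt (by positivity)
  have h1 := (((hasDerivAt_id x).div_const k).arsinh).const_mul (1 + k ^ 2 / 4)
  have h2 := ((((hasDerivAt_id x).pow 2).add_const (k ^ 2)).sqrt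
    (by simp only [id, Pi.pow_apply]; positivity))
  have h3 := h1.sub (((hasDerivAt_id x).mul h2).div_const 4)
  refine h3.congr_deriv ?_
  have e : √(1 + (x / k) ^ 2) = √(x ^ 2 + k ^ 2) / k := by
    rw [← sqrt_sq hk.le, ← sqrt_div (by positivity), sqrt_sq hk.le]
    congr 1
    field_simp
    ring
  simp only [id, Pi.pow_apply, smul_eq_mul, e]
  field_simp
  rw [hsq]
  ring

open Real in
theorem one_sub_half_sq_div_le {k : ℝ} (hk : 0 < k) (x : ℝ) :
    (1 - x ^ 2 / 2) / √(x ^ 2 + k ^ 2) ≤ 1 / √((1 + x ^ 2) * (x ^ 2 + k ^ 2)) := by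
  have hs : 0 < √(x ^ 2 + k ^ 2) := sqrt_pos.2 (by positivity)
  have hr : 0 < √(1 + x ^ 2) := sqrt_pos.2 (by positivity)
  rw [sqrt_mul (by positivity), ← div_div]
  gcongr
  rw [le_div_iff₀ hr]
  have h2 : √(1 + x ^ 2) ≤ 1 + x ^ 2 / 2 := sqrt_one_add_le (by nlinarith) |>.trans_eq (by ring)
  by_cases hx : 0 ≤ 1 - x ^ 2 / 2
  · nlinarith [mul_le_mul_of_nonneg_left h2 hx, sq_nonneg (x ^ 2)]
  · nlinarith

open Real Set in
theorem lowerPrimitive_le_integral_left {k a : ℝ} (hk : 0 < k) (hk1 : k < 1)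
    (ha : 0 ≤ a) (ha1 : a < 1) :
    lowerPrimitive k (k * a / √(1 - a ^ 2)) ≤
      ∫ t in (0:ℝ)..a, 1 / √((1 - t ^ 2) * (1 - (1 - k ^ 2) * t ^ 2)) := by
  have hd : ∀ t ∈ Icc 0 a, HasDerivAt (fun t => lowerPrimitive k (k * t / √(1 - t ^ 2)))
      ((1 - (k * t / √(1 - t ^ 2)) ^ 2 / 2) / √((k * t / √(1 - t ^ 2)) ^ 2 + k ^ 2) *
        (k / (√(1 - t ^ 2) * (1 - t ^ 2)))) t := by
    intro t ht
    have h0 : 0 < 1 - t ^ 2 := by nlinarith [ht.1, ht.2]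
    have hs := sqrt_pos.2 h0
    have hsq := sq_sqrt h0.le
    refine (hasDerivAt_lowerPrimitive hk _).comp t ?_
    have h1 := (((hasDerivAt_id t).pow 2).const_sub 1).sqrt (by simpa using h0.ne')
    refine (((hasDerivAt_id t).const_mul k).div h1 (by simpa using hs.ne')).congr_deriv ?_
    simp only [id, Pi.pow_apply]
    generalize √(1 - t ^ 2) = s at *
    rw [← hsq]
    field_simp
    linear_combination 2 * hsq
  have h := intervalIntegral.sub_le_integral_of_hasDeriv_right_of_le ha
    (fun t ht => (hd t ht).continuousAt.continuousWithinAt)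
    (fun t ht => (hd t (Ioo_subset_Icc_self ht)).hasDerivWithinAt)
    ((integrableOn_one_div_sqrt_mul (m := 1 - k ^ 2) (by nlinarith) (by nlinarith)).mono_set
      (Icc_subset_Icc_right ha1.le)) (fun t ht => ?_)
  · simpa [lowerPrimitive] using h
  · have h0 : 0 < 1 - t ^ 2 := by nlinarith [ht.1, ht.2]
    have hs := sqrt_pos.2 h0
    have hsq := sq_sqrt h0.le
    have hm : 0 < 1 - (1 - k ^ 2) * t ^ 2 := by nlinarith [mul_nonneg (sq_nonneg k) (sq_nonneg t)]
    refine (mul_le_mul_of_nonneg_right (one_sub_half_sq_div_le hk _) (by positivity)).trans_eq ?_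
    have e : (1 + (k * t / √(1 - t ^ 2)) ^ 2) * ((k * t / √(1 - t ^ 2)) ^ 2 + k ^ 2) =
        (k / (1 - t ^ 2)) ^ 2 * (1 - (1 - k ^ 2) * t ^ 2) := by
      rw [div_pow, hsq]
      field_simp
      ring
    rw [e, sqrt_mul (by positivity), sqrt_sq (by positivity), sqrt_mul h0.le]
    have := sqrt_pos.2 hm
    field_simp

open Real Set in
theorem lowerPrimitive_le_integral_right {k a : ℝ} (hk : 0 < k) (hk1 : k < 1)
    (ha : 0 < a) (ha1 : a ≤ 1) :
    lowerPrimitive k (√(1 - a ^ 2) / a) ≤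
      ∫ t in a..1, 1 / √((1 - t ^ 2) * (1 - (1 - k ^ 2) * t ^ 2)) := by
  have hd : ∀ t ∈ Ioo a 1, HasDerivAt (fun t => - lowerPrimitive k (√(1 - t ^ 2) / t))
      ((1 - (√(1 - t ^ 2) / t) ^ 2 / 2) / √((√(1 - t ^ 2) / t) ^ 2 + k ^ 2) *
        (1 / (√(1 - t ^ 2) * t ^ 2))) t := by
    intro t ht
    have ht0 : 0 < t := ha.trans ht.1
    have h0 : 0 < 1 - t ^ 2 := by nlinarith [ht.1, ht.2]
    have hs := sqrt_pos.2 h0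
    have hsq := sq_sqrt h0.le
    have h1 := (((hasDerivAt_id t).pow 2).const_sub 1).sqrt (by simpa using h0.ne')
    have h2 := h1.div (hasDerivAt_id t) ht0.ne'
    refine ((hasDerivAt_lowerPrimitive hk _).comp t h2).neg.congr_deriv ?_
    simp only [id, Pi.pow_apply, Pi.div_apply]
    rw [← mul_neg]
    congr 1
    generalize √(1 - t ^ 2) = s at *
    field_simp
    linear_combination 2 * hsq
  have hc : ContinuousOn (fun t => - lowerPrimitive k (√(1 - t ^ 2) / t)) (Icc a 1) := by
    have hG : Continuous (lowerPrimitive k) :=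
      continuous_iff_continuousAt.2 fun x => (hasDerivAt_lowerPrimitive hk x).continuousAt
    refine (hG.comp_continuousOn (ContinuousOn.div (by fun_prop) continuousOn_id ?_)).neg
    exact fun t ht => (ha.trans_le ht.1).ne'
  have h := intervalIntegral.sub_le_integral_of_hasDeriv_right_of_le ha1 hc
    (fun t ht => (hd t ht).hasDerivWithinAt)
    ((integrableOn_one_div_sqrt_mul (m := 1 - k ^ 2) (by nlinarith) (by nlinarith)).mono_set
      (Icc_subset_Icc_left ha.le)) (fun t ht => ?_)
  · simpa [lowerPrimitive] using h
  · have ht0 : 0 < t := ha.trans ht.1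
    have h0 : 0 < 1 - t ^ 2 := by nlinarith [ht.1, ht.2]
    have hs := sqrt_pos.2 h0
    have hsq := sq_sqrt h0.le
    have hm : 0 < 1 - (1 - k ^ 2) * t ^ 2 := by nlinarith [mul_nonneg (sq_nonneg k) (sq_nonneg t)]
    refine (mul_le_mul_of_nonneg_right (one_sub_half_sq_div_le hk _) (by positivity)).trans_eq ?_
    have e : (1 + (√(1 - t ^ 2) / t) ^ 2) * ((√(1 - t ^ 2) / t) ^ 2 + k ^ 2) =
        (1 / t ^ 2) ^ 2 * (1 - (1 - k ^ 2) * t ^ 2) := by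
      rw [div_pow, hsq]
      field_simp
      ring
    rw [e, sqrt_mul (by positivity), sqrt_sq (by positivity), sqrt_mul h0.le]
    have := sqrt_pos.2 hm
    field_simp

open Real Set in
theorem two_mul_lowerPrimitive_le_ellK' {k : ℝ} (hk : 0 < k) (hk1 : k < 1) :
    2 * lowerPrimitive k (√k) ≤ ellK' k := by
  have hr : 0 < √(1 + k) := sqrt_pos.2 (by linarith)
  have hrs : √(1 + k) ^ 2 = 1 + k := sq_sqrt (by linarith)
  have hks : √k ^ 2 = k := sq_sqrt hk.le
  have hk0 : 0 < √k := sqrt_pos.2 hk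
  set a : ℝ := 1 / √(1 + k) with ha_def
  have ha : 0 < a := by positivity
  have ha1 : a < 1 := by
    rw [ha_def, div_lt_one hr]
    exact lt_sqrt_of_sq_lt (by linarith)
  have hs : √(1 - a ^ 2) = √k * a := by
    rw [sqrt_eq_iff_mul_self_eq_of_pos (by positivity), ← sq, mul_pow, hks, ha_def, div_pow, hrs]
    field_simp
    ring
  have h1 := lowerPrimitive_le_integral_left hk hk1 ha.le ha1
  have h2 := lowerPrimitive_le_integral_right hk hk1 ha ha1.le
  have hi := integrableOn_one_div_sqrt_mul (m := 1 - k ^ 2) (by nlinarith) (by nlinarith)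
  have e1 : k * a / √(1 - a ^ 2) = √k := by
    rw [hs]
    field_simp
    exact hks.symm
  have e2 : √(1 - a ^ 2) / a = √k := by
    rw [hs]
    field_simp
  rw [e1] at h1
  rw [e2] at h2
  have h3 := intervalIntegral.integral_add_adjacent_intervals (a := 0) (b := a) (c := 1)
    ((intervalIntegrable_iff_integrableOn_Icc_of_le ha.le).2
      (hi.mono_set (Icc_subset_Icc_right ha1.le)))
    ((intervalIntegrable_iff_integrableOn_Icc_of_le ha1.le).2
      (hi.mono_set (Icc_subset_Icc_left ha.le)))
  unfold ellK'
  linarith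

open Real in
theorem arsinh_lower_bound {k : ℝ} (hk : 0 < k) (hk1 : k ≤ 0.13742) :
    1.7165 ≤ arsinh (√k / k) := by
  have hx : 2.6975 ≤ √k / k := by
    rw [sqrt_div_self', le_div_iff₀ (sqrt_pos.2 hk)]
    have : √k ≤ 0.37071 := sqrt_le_iff.2 ⟨by norm_num, by norm_num; linarith⟩
    linarith
  refine le_trans ?_ (arsinh_le_arsinh.2 hx)
  have hlog : 3.433 ≤ log 31 := by
    have h1 : log 31 = 5 * log 2 + log (31 / 32) := by
      rw [show (31 : ℝ) = 2 ^ 5 * (31 / 32) by norm_num, log_mul (by norm_num) (by norm_num),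
        log_pow]
      norm_num
    have h2 := one_sub_inv_le_log_of_pos (show (0 : ℝ) < 31 / 32 by norm_num)
    have h3 := log_two_gt_d9
    norm_num at h2 h3 ⊢
    linarith
  have hs : 2.8767 ≤ √(1 + 2.6975 ^ 2) := le_sqrt_of_sq_le (by norm_num)
  have h4 : log 31 ≤ 2 * arsinh 2.6975 := by
    rw [arsinh, ← Nat.cast_two, ← log_pow]
    refine log_le_log (by norm_num) ?_
    nlinarith
  linarith

/-- For `v = 1/√(27+15√3)`, the extremal length `6K(v)/K'(v)` of a face curve of
the punctured octahedron is strictly smaller than the extremal length `2√2` of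
an edge curve. -/
theorem face_lt_edge :
    6 * ellK (1 / Real.sqrt (27 + 15 * Real.sqrt 3))
        / ellK' (1 / Real.sqrt (27 + 15 * Real.sqrt 3))
      < 2 * Real.sqrt 2 := by
  have h3 : 1.732 ≤ √3 := Real.le_sqrt_of_sq_le (by norm_num)
  have hq : 7.2785 ≤ √(27 + 15 * √3) := Real.le_sqrt_of_sq_le (by norm_num at h3 ⊢; linarith)
  have hq' : √(27 + 15 * √3) ≤ 7.2801 := by
    have : √3 ≤ 1.7321 := Real.sqrt_le_iff.2 ⟨by norm_num, by norm_num⟩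
    exact Real.sqrt_le_iff.2 ⟨by norm_num, by norm_num at this ⊢; linarith⟩
  set k : ℝ := 1 / √(27 + 15 * √3) with hk_def
  have hk0 : 0.13736 ≤ k := by
    rw [hk_def, le_div_iff₀ (by linarith)]
    linarith
  have hk1 : k ≤ 0.1374 := by
    rw [hk_def, div_le_iff₀ (by linarith)]
    linarith
  clear_value k
  have hk : 0 < k := by linarith
  have hK : ellK k ≤ 1.58605 := by
    refine (ellK_le (by nlinarith)).trans ?_
    have : 0.9905 ≤ √(1 - k ^ 2) := Real.le_sqrt_of_sq_le (by nlinarith)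
    rw [div_le_iff₀ (by linarith)]
    linarith [Real.pi_lt_d4]
  have hK' : 3.367 ≤ ellK' k := by
    refine le_trans ?_ (two_mul_lowerPrimitive_le_ellK' hk (by linarith))
    have hA := arsinh_lower_bound hk (by linarith)
    have e : √k * √(√k ^ 2 + k ^ 2) ≤ 0.1466 := by
      rw [Real.sq_sqrt hk.le, ← Real.sqrt_mul hk.le]
      refine Real.sqrt_le_iff.2 ⟨by norm_num, ?_⟩
      nlinarith [pow_le_pow_left₀ hk.le hk1 2, pow_le_pow_left₀ hk.le hk1 3]
    have hm : 1.0047 * 1.7165 ≤ (1 + k ^ 2 / 4) * Real.arsinh (√k / k) :=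
      mul_le_mul (by nlinarith) hA (by norm_num) (by positivity)
    rw [lowerPrimitive]
    linarith
  have h2 : 1.4142 ≤ √2 := Real.le_sqrt_of_sq_le (by norm_num)
  rw [div_lt_iff₀ (by linarith)]
  nlinarith
end
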